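/- Let (φ_{t,s})_{s≤t∈I} be an evolution family over parallel slit half-planes (D_t)_{t∈I}. Fix t₀ ∈ I, a bounded open set U with closure(U) ⊆ D_{t₀}, and δ > 0 such that closure(U) ⊆ D_t for all t ∈ I with |t − t₀| ≤ δ. Let 𝒯 = {(s,t) : s ∈ I, |s − t₀| ≤ δ, t ∈ I, s ≤ t}. Then the map (s,t) ↦ φ_{t,s}|_U from 𝒯 into the space of holomorphic functions on U, endowed with the topology of locally uniform convergence, is continuous: whenever (s_n, t_n) ∈ 𝒯 converge to (s,t) ∈ 𝒯, the functions φ_{t_n,s_n} converge to φ_{t,s} locally uniformly on U. -/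

import Mathlib

open Complex Set Filter Topology Bornology MeasureTheory Metric

noncomputable section

/-- The upper half-plane `ℍ = {z : ℂ | 0 < Im z}`. -/
def UHP : Set ℂ := {z : ℂ | 0 < z.im}

/-- The half-plane `ℍ_η = {z : ℂ | η < Im z}`. -/
def HP (η : ℝ) : Set ℂ := {z : ℂ | η < z.im}

/-- The sector `△_θ = {z : ℂ | θ < arg z < π - θ}`. -/
def Sector (θ : ℝ) : Set ℂ :=
  {z : ℂ | θ < Complex.arg z ∧ Complex.arg z < Real.pi - θ}

/-- A closed horizontal line segment of positive length contained in `ℍ`. -/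
def IsHorizontalSlit (C : Set ℂ) : Prop :=
  ∃ y xl xr : ℝ, 0 < y ∧ xl < xr ∧
    C = {z : ℂ | z.im = y ∧ z.re ∈ Set.Icc xl xr}

/-- A parallel slit half-plane with `N` slits: `ℍ` minus `N` pairwise disjoint
closed horizontal segments of positive length. -/
def IsParallelSlitHalfPlaneN (N : ℕ) (D : Set ℂ) : Prop :=
  ∃ C : Fin N → Set ℂ,
    (∀ j, IsHorizontalSlit (C j)) ∧
    (Pairwise fun i j => Disjoint (C i) (C j)) ∧
    D = UHP \ ⋃ j, C j

/-- A parallel slit half-plane (with some number of slits). -/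
def IsParallelSlitHalfPlane (D : Set ℂ) : Prop :=
  ∃ N : ℕ, IsParallelSlitHalfPlaneN N D

/-- (H.1): hydrodynamic normalization at infinity. -/
def SatisfiesH1 (D : Set ℂ) (f : ℂ → ℂ) : Prop :=
  ∃ η : ℝ, 0 ≤ η ∧ HP η ⊆ D ∧
    Tendsto (fun z => f z - z) (cobounded ℂ ⊓ 𝓟 (HP η)) (𝓝 0)

/-- (H.2): `f` has angular residue `c` at infinity, i.e. `z (f z - z) → -c`
as `z → ∞` within every sector `△_θ`. -/
def SatisfiesH2 (f : ℂ → ℂ) (c : ℂ) : Prop :=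
  ∀ θ : ℝ, 0 < θ → θ < Real.pi / 2 →
    Tendsto (fun z => z * (f z - z)) (cobounded ℂ ⊓ 𝓟 (Sector θ)) (𝓝 (-c))

/-- `F` is an ℍ-hull: relatively closed in `ℍ` with `ℍ \ F` a simply connected
domain. -/
def IsHHull (F : Set ℂ) : Prop :=
  F ⊆ UHP ∧ closure F ∩ UHP ⊆ F ∧
    IsConnected (UHP \ F) ∧ SimplyConnectedSpace ↥(UHP \ F)

/-- `η_D = min {Im w | w ∈ ℍ \ D}`. -/
def etaD (D : Set ℂ) : ℝ := sInf (Complex.im '' (UHP \ D))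

/-- A (chordal) evolution family `φ t s : D s → D t` (for `s ≤ t` in `I`) over
parallel slit half-planes `D t`, where `lam t` is the angular residue of
`φ t 0` at infinity. -/
structure IsEvolutionFamily (I : Set ℝ) (D : ℝ → Set ℂ)
    (φ : ℝ → ℝ → ℂ → ℂ) (lam : ℝ → ℂ) : Prop where
  slit : ∀ t ∈ I, IsParallelSlitHalfPlane (D t)
  mapsTo : ∀ s ∈ I, ∀ t ∈ I, s ≤ t → Set.MapsTo (φ t s) (D s) (D t)
  holo : ∀ s ∈ I, ∀ t ∈ I, s ≤ t → DifferentiableOn ℂ (φ t s) (D s)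
  inj : ∀ s ∈ I, ∀ t ∈ I, s ≤ t → Set.InjOn (φ t s) (D s)
  h1 : ∀ s ∈ I, ∀ t ∈ I, s ≤ t → SatisfiesH1 (D s) (φ t s)
  h2 : ∀ s ∈ I, ∀ t ∈ I, s ≤ t → ∃ c : ℂ, SatisfiesH2 (φ t s) c
  h3 : ∀ s ∈ I, ∀ t ∈ I, s ≤ t → IsHHull (D t \ φ t s '' D s)
  ef1 : ∀ t ∈ I, Set.EqOn (φ t t) id (D t)
  ef2 : ∀ s ∈ I, ∀ t ∈ I, ∀ u ∈ I, s ≤ t → t ≤ u →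
    ∀ z ∈ D s, φ u s z = φ u t (φ t s z)
  lam_res : ∀ t ∈ I, SatisfiesH2 (φ t 0) (lam t)
  ef3 : ContinuousOn lam I

/-- A (chordal) Loewner chain `f t : D t → Dcod` over parallel slit
half-planes `D t` with codomain `Dcod`, where `ell t` is the angular residue
of `f t` at infinity. -/
structure IsLoewnerChain (I : Set ℝ) (D : ℝ → Set ℂ) (Dcod : Set ℂ)
    (f : ℝ → ℂ → ℂ) (ell : ℝ → ℂ) : Prop where
  slit : ∀ t ∈ I, IsParallelSlitHalfPlane (D t)
  slitcod : IsParallelSlitHalfPlane Dcod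
  mapsTo : ∀ t ∈ I, Set.MapsTo (f t) (D t) Dcod
  holo : ∀ t ∈ I, DifferentiableOn ℂ (f t) (D t)
  inj : ∀ t ∈ I, Set.InjOn (f t) (D t)
  h1 : ∀ t ∈ I, SatisfiesH1 (D t) (f t)
  h2 : ∀ t ∈ I, SatisfiesH2 (f t) (ell t)
  h3 : ∀ t ∈ I, IsHHull (Dcod \ f t '' D t)
  lc1 : ∀ s ∈ I, ∀ t ∈ I, s ≤ t → f s '' D s ⊆ f t '' D t
  lc2 : ContinuousOn ell I

/-- `(Lip)_μ`: Lipschitz continuity of `t ↦ f t` w.r.t. the measure `μ`,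
uniformly on compact subsets of `D`. -/
def SatisfiesLip (I : Set ℝ) (μ : Measure ℝ) (D : Set ℂ)
    (f : ℝ → ℂ → ℂ) : Prop :=
  ∀ K : Set ℂ, K ⊆ D → IsCompact K → ∃ L : ℝ,
    ∀ s ∈ I, ∀ t ∈ I, s ≤ t → ∀ z ∈ K,
      ‖f t z - f s z‖ ≤ L * (μ (Set.Ioc s t)).toReal

/-- `(AC)_μ`: absolute continuity of `t ↦ f t` w.r.t. the measure `μ`,
uniformly on compact subsets of `D`. -/
def SatisfiesAC (I : Set ℝ) (μ : Measure ℝ) (D : Set ℂ)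
    (f : ℝ → ℂ → ℂ) : Prop :=
  ∀ K : Set ℂ, K ⊆ D → IsCompact K →
    ∃ ν : Measure ℝ, ν ≪ μ ∧
      (∀ a ∈ I, ∀ b ∈ I, ν (Set.Icc a b) < ⊤) ∧
      ∀ s ∈ I, ∀ t ∈ I, s ≤ t → ∀ z ∈ K,
        ‖f t z - f s z‖ ≤ (ν (Set.Ioc s t)).toReal

/-- The symmetric difference quotient
`(f (t+δ) z - f (t-δ) z) / μ((t-δ, t+δ))`. -/
def symmQuot (μ : Measure ℝ) (f : ℝ → ℂ → ℂ) (t δ : ℝ) (z : ℂ) : ℂ :=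
  (f (t + δ) z - f (t - δ) z) / ((μ (Set.Ioo (t - δ) (t + δ))).toReal : ℂ)

/-- A cross-cut of a domain `G`. -/
def IsCrossCut (G C : Set ℂ) : Prop :=
  ∃ c : ℝ → ℂ, ContinuousOn c (Set.Icc 0 1) ∧ Set.InjOn c (Set.Icc 0 1) ∧
    c 0 ∈ frontier G ∧ c 1 ∈ frontier G ∧ c '' Set.Ioo 0 1 ⊆ G ∧
    C = c '' Set.Icc 0 1

/-- `C` separates `S` from `∞` in `G`: `S` is disjoint from the unbounded
connected component of `G \ C`. -/
def SeparatesFromInfty (G C S : Set ℂ) : Prop :=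
  ∀ z ∈ S ∩ (G \ C), Bornology.IsBounded (connectedComponentIn (G \ C) z)

/-- The local growth property of a family of hulls `(F t)_{t ∈ [0,T]}` in `D`. -/
def LocalGrowth (T : ℝ) (D : Set ℂ) (F : ℝ → Set ℂ) : Prop :=
  ∀ ε : ℝ, 0 < ε → ∃ δ ∈ Set.Ioo 0 T, ∀ t ∈ Set.Icc 0 (T - δ),
    ∃ C : Set ℂ, IsCrossCut (D \ F t) C ∧ Metric.diam C < ε ∧
      SeparatesFromInfty (D \ F t) C (F (t + δ) \ F t)

/-- Carathéodory kernel of a sequence of domains w.r.t. the point `a`. -/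
def kernelAt (a : ℂ) (G : ℕ → Set ℂ) : Set ℂ :=
  connectedComponentIn
    {z : ℂ | ∃ r > 0, ∃ N : ℕ, ∀ n ≥ N, Metric.ball z r ⊆ G n} a

/-- Left continuity in Carathéodory's sense of `(F t)` at `t₀`. -/
def CaratheodoryLeftContinuousAt (D : Set ℂ) (F : ℝ → Set ℂ)
    (T t₀ : ℝ) : Prop :=
  ∀ a ∈ D \ F T, ∀ s : ℕ → ℝ,
    Monotone s → (∀ n, s n ∈ Set.Ico 0 t₀) → Tendsto s atTop (𝓝 t₀) →
      kernelAt a (fun n => D \ F (s n)) = D \ F t₀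

/-- The boundary of the rectangle `[a, b] × [c, d]`. -/
def rectBd (a b c d : ℝ) : Set ℂ :=
  {z : ℂ | z.re ∈ Icc a b ∧ z.im ∈ Icc c d ∧ (z.re = a ∨ z.re = b ∨ z.im = c ∨ z.im = d)}

/-- The integral of `F` along the positively oriented boundary of `[a, b] × [c, d]`. -/
def rectInt (F : ℂ → ℂ) (a b c d : ℝ) : ℂ :=
  (∫ x : ℝ in a..b, F (x + c * I)) - (∫ x : ℝ in a..b, F (x + d * I)) +
    I * (∫ y : ℝ in c..d, F (b + y * I)) - I * (∫ y : ℝ in c..d, F (a + y * I))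

section RectInt

variable {a b c d : ℝ} {F H : ℂ → ℂ}

lemma isCompact_rectBd : IsCompact (rectBd a b c d) := by
  have h : IsCompact (Icc a b ×ℂ Icc c d) := isCompact_Icc.reProdIm isCompact_Icc
  refine h.of_isClosed_subset ?_ fun z hz => ⟨hz.1, hz.2.1⟩
  have h1 : IsClosed {z : ℂ | z.re ∈ Icc a b} := isClosed_Icc.preimage continuous_re
  have h2 : IsClosed {z : ℂ | z.im ∈ Icc c d} := isClosed_Icc.preimage continuous_im
  have h3 : ∀ t : ℝ, IsClosed {z : ℂ | z.re = t} := fun t =>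
    isClosed_singleton.preimage continuous_re
  have h4 : ∀ t : ℝ, IsClosed {z : ℂ | z.im = t} := fun t =>
    isClosed_singleton.preimage continuous_im
  exact h1.inter (h2.inter ((h3 a).union ((h3 b).union ((h4 c).union (h4 d)))))

lemma bottom_mem_rectBd (hcd : c ≤ d) {x : ℝ} (hx : x ∈ Icc a b) :
    (x + c * I : ℂ) ∈ rectBd a b c d := by
  simp only [rectBd, mem_ofPred_eq]; simpa using ⟨hx, hcd⟩

lemma top_mem_rectBd (hcd : c ≤ d) {x : ℝ} (hx : x ∈ Icc a b) :
    (x + d * I : ℂ) ∈ rectBd a b c d := by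
  simp only [rectBd, mem_ofPred_eq]; simpa using ⟨hx, hcd⟩

lemma right_mem_rectBd (hab : a ≤ b) {y : ℝ} (hy : y ∈ Icc c d) :
    (b + y * I : ℂ) ∈ rectBd a b c d := by
  simp only [rectBd, mem_ofPred_eq]; simpa using ⟨hab, hy⟩

lemma left_mem_rectBd (hab : a ≤ b) {y : ℝ} (hy : y ∈ Icc c d) :
    (a + y * I : ℂ) ∈ rectBd a b c d := by
  simp only [rectBd, mem_ofPred_eq]; simpa using ⟨hab, hy⟩

lemma continuousOn_horizontal {s : Set ℂ} (hF : ContinuousOn F s) {t : Set ℝ} {y : ℝ}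
    (h : ∀ x ∈ t, (x + y * I : ℂ) ∈ s) : ContinuousOn (fun x : ℝ => F (x + y * I)) t :=
  hF.comp (by fun_prop) h

lemma continuousOn_vertical {s : Set ℂ} (hF : ContinuousOn F s) {t : Set ℝ} {x : ℝ}
    (h : ∀ y ∈ t, (x + y * I : ℂ) ∈ s) : ContinuousOn (fun y : ℝ => F (x + y * I)) t :=
  hF.comp (by fun_prop) h

lemma intervalIntegrable_horizontal {s : Set ℂ} (hF : ContinuousOn F s) (hab : a ≤ b) {y : ℝ}
    (h : ∀ x ∈ Icc a b, (x + y * I : ℂ) ∈ s) :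
    IntervalIntegrable (fun x : ℝ => F (x + y * I)) volume a b :=
  (continuousOn_horizontal hF h).intervalIntegrable_of_Icc hab

lemma intervalIntegrable_vertical {s : Set ℂ} (hF : ContinuousOn F s) (hcd : c ≤ d) {x : ℝ}
    (h : ∀ y ∈ Icc c d, (x + y * I : ℂ) ∈ s) :
    IntervalIntegrable (fun y : ℝ => F (x + y * I)) volume c d :=
  (continuousOn_vertical hF h).intervalIntegrable_of_Icc hcd

lemma integral_horizontal_eq_sub {P : ℂ → ℂ} (hab : a ≤ b) {y : ℝ} {s : Set ℂ}
    (h : ∀ x ∈ Icc a b, (x + y * I : ℂ) ∈ s) (hF : ContinuousOn F s)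
    (hP : ∀ w ∈ s, HasDerivAt P (F w) w) :
    ∫ x : ℝ in a..b, F (x + y * I) = P (b + y * I) - P (a + y * I) := by
  refine intervalIntegral.integral_eq_sub_of_hasDerivAt (f := fun x : ℝ => P (x + y * I)) ?_
    (intervalIntegrable_horizontal hF hab h)
  intro x hx
  rw [uIcc_of_le hab] at hx
  have h1 : HasDerivAt (fun z : ℂ => z + y * I) 1 (x : ℂ) := (hasDerivAt_id _).add_const _
  simpa using (HasDerivAt.comp (x : ℂ) (hP _ (h x hx)) h1).comp_ofReal

lemma integral_vertical_eq_sub {P : ℂ → ℂ} (hcd : c ≤ d) {x : ℝ} {s : Set ℂ}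
    (h : ∀ y ∈ Icc c d, (x + y * I : ℂ) ∈ s) (hF : ContinuousOn F s)
    (hP : ∀ w ∈ s, HasDerivAt P (F w) w) :
    I * ∫ y : ℝ in c..d, F (x + y * I) = P (x + d * I) - P (x + c * I) := by
  rw [← intervalIntegral.integral_const_mul]
  refine intervalIntegral.integral_eq_sub_of_hasDerivAt (f := fun y : ℝ => P (x + y * I)) ?_
    ((intervalIntegrable_vertical hF hcd h).const_mul _)
  intro y hy
  rw [uIcc_of_le hcd] at hy
  have h1 : HasDerivAt (fun z : ℂ => x + z * I) I (y : ℂ) := by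
    simpa using ((hasDerivAt_id (y : ℂ)).mul_const I).const_add (x : ℂ)
  simpa [mul_comm] using (HasDerivAt.comp (y : ℂ) (hP _ (h y hy)) h1).comp_ofReal

lemma rectInt_eq_zero_of_primitive {P : ℂ → ℂ} (hab : a ≤ b) (hcd : c ≤ d)
    (hF : ContinuousOn F (rectBd a b c d)) (hP : ∀ w ∈ rectBd a b c d, HasDerivAt P (F w) w) :
    rectInt F a b c d = 0 := by
  rw [rectInt, integral_horizontal_eq_sub hab (fun x => bottom_mem_rectBd hcd) hF hP,
    integral_horizontal_eq_sub hab (fun x => top_mem_rectBd hcd) hF hP,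
    integral_vertical_eq_sub hcd (fun x => right_mem_rectBd hab) hF hP,
    integral_vertical_eq_sub hcd (fun x => left_mem_rectBd hab) hF hP]
  ring

lemma rectInt_congr (hab : a ≤ b) (hcd : c ≤ d) (h : EqOn F H (rectBd a b c d)) :
    rectInt F a b c d = rectInt H a b c d := by
  have e1 : ∫ x : ℝ in a..b, F (x + c * I) = ∫ x : ℝ in a..b, H (x + c * I) :=
    intervalIntegral.integral_congr fun x hx =>
      h (bottom_mem_rectBd hcd (by rwa [uIcc_of_le hab] at hx))
  have e2 : ∫ x : ℝ in a..b, F (x + d * I) = ∫ x : ℝ in a..b, H (x + d * I) :=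
    intervalIntegral.integral_congr fun x hx =>
      h (top_mem_rectBd hcd (by rwa [uIcc_of_le hab] at hx))
  have e3 : ∫ y : ℝ in c..d, F (b + y * I) = ∫ y : ℝ in c..d, H (b + y * I) :=
    intervalIntegral.integral_congr fun x hx =>
      h (right_mem_rectBd hab (by rwa [uIcc_of_le hcd] at hx))
  have e4 : ∫ y : ℝ in c..d, F (a + y * I) = ∫ y : ℝ in c..d, H (a + y * I) :=
    intervalIntegral.integral_congr fun x hx =>
      h (left_mem_rectBd hab (by rwa [uIcc_of_le hcd] at hx))
  rw [rectInt, rectInt, e1, e2, e3, e4]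

lemma rectInt_add (hab : a ≤ b) (hcd : c ≤ d) (hF : ContinuousOn F (rectBd a b c d))
    (hH : ContinuousOn H (rectBd a b c d)) :
    rectInt (fun w => F w + H w) a b c d = rectInt F a b c d + rectInt H a b c d := by
  simp only [rectInt]
  rw [intervalIntegral.integral_add
      (intervalIntegrable_horizontal hF hab fun x => bottom_mem_rectBd hcd)
      (intervalIntegrable_horizontal hH hab fun x => bottom_mem_rectBd hcd),
    intervalIntegral.integral_add
      (intervalIntegrable_horizontal hF hab fun x => top_mem_rectBd hcd)
      (intervalIntegrable_horizontal hH hab fun x => top_mem_rectBd hcd),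
    intervalIntegral.integral_add
      (intervalIntegrable_vertical hF hcd fun x => right_mem_rectBd hab)
      (intervalIntegrable_vertical hH hcd fun x => right_mem_rectBd hab),
    intervalIntegral.integral_add
      (intervalIntegrable_vertical hF hcd fun x => left_mem_rectBd hab)
      (intervalIntegrable_vertical hH hcd fun x => left_mem_rectBd hab)]
  ring

/-- Two rectangles with a common vertical side. -/
lemma rectInt_add_adjacent {e : ℝ} (hab : a ≤ b) (hbe : b ≤ e) (hcd : c ≤ d)
    (h1 : ContinuousOn F (rectBd a b c d)) (h2 : ContinuousOn F (rectBd b e c d)) :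
    rectInt F a e c d = rectInt F a b c d + rectInt F b e c d := by
  simp only [rectInt]
  rw [← intervalIntegral.integral_add_adjacent_intervals
      (intervalIntegrable_horizontal h1 hab fun x => bottom_mem_rectBd hcd)
      (intervalIntegrable_horizontal h2 hbe fun x => bottom_mem_rectBd hcd),
    ← intervalIntegral.integral_add_adjacent_intervals
      (intervalIntegrable_horizontal h1 hab fun x => top_mem_rectBd hcd)
      (intervalIntegrable_horizontal h2 hbe fun x => top_mem_rectBd hcd)]
  ring

lemma rectInt_eq_zero_of_differentiableOn (hab : a ≤ b) (hcd : c ≤ d)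
    (hF : DifferentiableOn ℂ F (Icc a b ×ℂ Icc c d)) : rectInt F a b c d = 0 := by
  have := integral_boundary_rect_eq_zero_of_differentiableOn F ⟨a, c⟩ ⟨b, d⟩
    (by simpa only [uIcc_of_le hab, uIcc_of_le hcd] using hF)
  simpa [rectInt] using this

/-- The integral of `1 / (w - z)` around a rectangle enclosing `z` does not vanish. -/
lemma rectInt_inv_ne_zero {z : ℂ} (h1 : a < z.re) (h2 : z.re < b) (h3 : c < z.im)
    (h4 : z.im < d) : rectInt (fun w => (w - z)⁻¹) a b c d ≠ 0 := by
  have hne : ∀ w ∈ rectBd a b c d, w - z ≠ 0 := by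
    rintro w ⟨-, -, h⟩ h0
    rw [sub_eq_zero] at h0
    subst h0
    rcases h with h | h | h | h <;> linarith
  have hc : ContinuousOn (fun w => (w - z)⁻¹) (rectBd a b c d) :=
    (continuousOn_id.sub continuousOn_const).inv₀ hne
  have hab : a ≤ b := by linarith
  have hcd : c ≤ d := by linarith
  have i1 := intervalIntegrable_horizontal hc hab fun x => bottom_mem_rectBd hcd
  have i2 := intervalIntegrable_horizontal hc hab fun x => top_mem_rectBd hcd
  have i3 := intervalIntegrable_vertical hc hcd fun x => right_mem_rectBd hab
  have i4 := intervalIntegrable_vertical hc hcd fun x => left_mem_rectBd hab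
  have e1 : (∫ x : ℝ in a..b, ((x + c * I : ℂ) - z)⁻¹).im
      = ∫ x : ℝ in a..b, (((x + c * I : ℂ) - z)⁻¹).im :=
    (imCLM.intervalIntegral_comp_comm i1).symm
  have e2 : (∫ x : ℝ in a..b, ((x + d * I : ℂ) - z)⁻¹).im
      = ∫ x : ℝ in a..b, (((x + d * I : ℂ) - z)⁻¹).im :=
    (imCLM.intervalIntegral_comp_comm i2).symm
  have e3 : (∫ y : ℝ in c..d, ((b + y * I : ℂ) - z)⁻¹).re
      = ∫ y : ℝ in c..d, (((b + y * I : ℂ) - z)⁻¹).re :=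
    (reCLM.intervalIntegral_comp_comm i3).symm
  have e4 : (∫ y : ℝ in c..d, ((a + y * I : ℂ) - z)⁻¹).re
      = ∫ y : ℝ in c..d, (((a + y * I : ℂ) - z)⁻¹).re :=
    (reCLM.intervalIntegral_comp_comm i4).symm
  have n1 : 0 ≤ ∫ x : ℝ in a..b, (((x + c * I : ℂ) - z)⁻¹).im := by
    refine intervalIntegral.integral_nonneg hab fun x _ => ?_
    rw [inv_im]
    exact div_nonneg (by simp; linarith) (normSq_nonneg _)
  have n2 : ∫ x : ℝ in a..b, (((x + d * I : ℂ) - z)⁻¹).im ≤ 0 := by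
    rw [← neg_nonneg, ← intervalIntegral.integral_neg]
    refine intervalIntegral.integral_nonneg hab fun x _ => ?_
    rw [inv_im, ← neg_div, neg_neg]
    exact div_nonneg (by simp; linarith) (normSq_nonneg _)
  have n3 : 0 < ∫ y : ℝ in c..d, (((b + y * I : ℂ) - z)⁻¹).re := by
    refine intervalIntegral.intervalIntegral_pos_of_pos_on
      ⟨reCLM.integrable_comp i3.1, reCLM.integrable_comp i3.2⟩ ?_ (by linarith)
    intro y hy
    rw [inv_re]
    refine div_pos (by simp; linarith) (normSq_pos.2 (hne _ ?_))
    exact right_mem_rectBd hab (Ioo_subset_Icc_self hy)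
  have n4 : ∫ y : ℝ in c..d, (((a + y * I : ℂ) - z)⁻¹).re ≤ 0 := by
    rw [← neg_nonneg, ← intervalIntegral.integral_neg]
    refine intervalIntegral.integral_nonneg hcd fun x _ => ?_
    rw [inv_re, ← neg_div]
    exact div_nonneg (by simp; linarith) (normSq_nonneg _)
  intro h
  have := congrArg Complex.im h
  simp only [rectInt, sub_im, add_im, I_mul_im, zero_im] at this
  rw [e1, e2, e3, e4] at this
  linarith

end RectInt

/-- The integral of `f' / (f - p)` around a rectangle: `2πi` times the winding number around `p`
of the image of the boundary. -/
def rectWind (f : ℂ → ℂ) (a b c d : ℝ) (p : ℂ) : ℂ :=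
  rectInt (fun w => deriv f w / (f w - p)) a b c d

section RectWind

variable {a b c d : ℝ} {D : Set ℂ} {f : ℂ → ℂ}

lemma continuousOn_logDeriv_sub (hD : IsOpen D) (hf : DifferentiableOn ℂ f D) {s : Set ℂ}
    (hs : s ⊆ D) {p : ℂ} (hp : ∀ w ∈ s, f w ≠ p) :
    ContinuousOn (fun w => deriv f w / (f w - p)) s :=
  ((hf.deriv hD).continuousOn.mono hs).div ((hf.continuousOn.mono hs).sub continuousOn_const)
    fun w hw => sub_ne_zero.2 (hp w hw)

lemma rectWind_eq_of_norm_lt (hab : a ≤ b) (hcd : c ≤ d) (hD : IsOpen D)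
    (hf : DifferentiableOn ℂ f D) (hs : rectBd a b c d ⊆ D) {p p₀ : ℂ}
    (h : ∀ w ∈ rectBd a b c d, ‖p - p₀‖ < ‖f w - p₀‖) :
    rectWind f a b c d p = rectWind f a b c d p₀ := by
  have h0 : ∀ w ∈ rectBd a b c d, f w - p₀ ≠ 0 := fun w hw =>
    norm_pos_iff.1 ((norm_nonneg _).trans_lt (h w hw))
  have h1 : ∀ w ∈ rectBd a b c d, f w - p ≠ 0 := by
    intro w hw h2
    have := h w hw
    rw [sub_eq_zero.1 h2] at this
    exact lt_irrefl _ this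
  have c0 := continuousOn_logDeriv_sub hD hf hs fun w hw => sub_ne_zero.1 (h0 w hw)
  have c1 := continuousOn_logDeriv_sub hD hf hs fun w hw => sub_ne_zero.1 (h1 w hw)
  have key : rectInt (fun w => deriv f w / (f w - p) + -(deriv f w / (f w - p₀))) a b c d = 0 := by
    refine rectInt_eq_zero_of_primitive (P := fun w => log ((f w - p) / (f w - p₀))) hab hcd
      (c1.add c0.neg) fun w hw => ?_
    have hd : HasDerivAt f (deriv f w) w :=
      (hf.differentiableAt (hD.mem_nhds (hs hw))).hasDerivAt
    have hsl : (f w - p) / (f w - p₀) ∈ slitPlane := by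
      have e : (f w - p) / (f w - p₀) = 1 + (p₀ - p) / (f w - p₀) := by
        field_simp [h0 w hw]; ring
      rw [e]
      refine mem_slitPlane_of_norm_lt_one ?_
      rw [norm_div, norm_sub_rev, div_lt_one (norm_pos_iff.2 (h0 w hw))]
      exact h w hw
    have := ((hd.sub_const p).div (hd.sub_const p₀) (h0 w hw)).clog hsl
    refine this.congr_deriv ?_
    have := h0 w hw
    have := h1 w hw
    simp only [Pi.div_apply]
    field_simp
    ring
  rw [rectInt_add (H := fun w => -(deriv f w / (f w - p₀))) hab hcd c1 c0.neg] at key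
  have hneg : rectInt (fun w => -(deriv f w / (f w - p₀))) a b c d
      = -rectWind f a b c d p₀ := by
    simp only [rectInt, rectWind, intervalIntegral.integral_neg]
    ring
  rw [hneg, ← sub_eq_add_neg] at key
  exact sub_eq_zero.1 key

lemma rectWind_eventually_eq (hab : a ≤ b) (hcd : c ≤ d) (hD : IsOpen D)
    (hf : DifferentiableOn ℂ f D) (hs : rectBd a b c d ⊆ D) {p₀ : ℂ}
    (h : ∀ w ∈ rectBd a b c d, f w ≠ p₀) :
    ∀ᶠ p in 𝓝 p₀, rectWind f a b c d p = rectWind f a b c d p₀ := by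
  have hne : (rectBd a b c d).Nonempty := ⟨_, bottom_mem_rectBd hcd (left_mem_Icc.2 hab)⟩
  obtain ⟨w₀, hw₀, hmin⟩ := isCompact_rectBd.exists_isMinOn hne
    (((hf.continuousOn.mono hs).sub continuousOn_const).norm : ContinuousOn (fun w => ‖f w - p₀‖) _)
  have hpos : 0 < ‖f w₀ - p₀‖ := norm_pos_iff.2 (sub_ne_zero.2 (h w₀ hw₀))
  filter_upwards [Metric.ball_mem_nhds p₀ hpos] with p hp
  refine rectWind_eq_of_norm_lt hab hcd hD hf hs fun w hw => ?_
  rw [mem_ball_iff_norm] at hp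
  exact hp.trans_le (hmin hw)

lemma rectWind_eq_zero_of_norm_lt (hab : a ≤ b) (hcd : c ≤ d) (hD : IsOpen D)
    (hf : DifferentiableOn ℂ f D) (hs : rectBd a b c d ⊆ D) {p : ℂ}
    (h : ∀ w ∈ rectBd a b c d, ‖f w‖ < ‖p‖) : rectWind f a b c d p = 0 := by
  have h1 : ∀ w ∈ rectBd a b c d, f w ≠ p := by
    intro w hw h2
    have := h w hw
    rw [h2] at this
    exact lt_irrefl _ this
  refine rectInt_eq_zero_of_primitive (P := fun w => log (1 + -f w / p)) hab hcd
    (continuousOn_logDeriv_sub hD hf hs h1) fun w hw => ?_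
  have hd : HasDerivAt f (deriv f w) w := (hf.differentiableAt (hD.mem_nhds (hs hw))).hasDerivAt
  have hp : p ≠ 0 := norm_pos_iff.1 ((norm_nonneg _).trans_lt (h w hw))
  have hsl : 1 + -f w / p ∈ slitPlane := by
    refine mem_slitPlane_of_norm_lt_one ?_
    rw [norm_div, norm_neg, div_lt_one (norm_pos_iff.2 hp)]
    exact h w hw
  refine (((hd.neg.div_const p).const_add 1).clog hsl).congr_deriv ?_
  have h2 : f w - p ≠ 0 := sub_ne_zero.2 (h1 w hw)
  have h3 : p - f w ≠ 0 := sub_ne_zero.2 (h1 w hw).symm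
  have e : 1 + -f w / p = (p - f w) / p := by field_simp; ring
  simp only [Pi.neg_apply]
  rw [e]
  field_simp
  ring

lemma rectWind_eq_zero_of_exp_eq {L : ℂ → ℂ} {p : ℂ} (hab : a ≤ b) (hcd : c ≤ d) (hD : IsOpen D)
    (hf : DifferentiableOn ℂ f D) (hs : rectBd a b c d ⊆ D) (hL : ContinuousOn L D)
    (hexp : ∀ w ∈ D, exp (L w) = f w - p) : rectWind f a b c d p = 0 := by
  have h1 : ∀ w ∈ D, f w - p ≠ 0 := fun w hw => by rw [← hexp w hw]; exact exp_ne_zero _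
  refine rectInt_eq_zero_of_primitive (P := L) hab hcd
    (continuousOn_logDeriv_sub hD hf hs fun w hw => sub_ne_zero.1 (h1 w (hs hw))) fun w hw => ?_
  have hwD := hs hw
  have hd : HasDerivAt f (deriv f w) w := (hf.differentiableAt (hD.mem_nhds hwD)).hasDerivAt
  have hlog : HasDerivAt (fun z => L w + log ((f z - p) / (f w - p)))
      (deriv f w / (f w - p)) w := by
    have hsl : (f w - p) / (f w - p) ∈ slitPlane := by
      rw [div_self (h1 w hwD)]; exact one_mem_slitPlane
    refine ((((hd.sub_const p).div_const (f w - p)).clog hsl).const_add (L w)).congr_deriv ?_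
    rw [div_self (h1 w hwD), div_one]
  refine hlog.congr_of_eventuallyEq ?_
  have hLc : ContinuousAt L w := hL.continuousAt (hD.mem_nhds hwD)
  filter_upwards [hD.mem_nhds hwD, hLc.eventually (Metric.ball_mem_nhds (L w) one_pos)]
    with z hz hzb
  rw [← hexp z hz, ← hexp w hwD, ← exp_sub]
  rw [dist_eq_norm] at hzb
  have him : |(L z - L w).im| < 1 := (abs_im_le_norm _).trans_lt hzb
  rw [abs_lt] at him
  rw [log_exp (by linarith [Real.pi_gt_three]) (by linarith [Real.pi_gt_three])]
  ring

lemma rectWind_eq_on_preconnected (hab : a ≤ b) (hcd : c ≤ d) (hD : IsOpen D)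
    (hf : DifferentiableOn ℂ f D) (hinj : InjOn f D) (hs : rectBd a b c d ⊆ D) {A : Set ℂ}
    (hA : IsPreconnected A) (hAD : A ⊆ D) (hdisj : Disjoint A (rectBd a b c d)) {z z' : ℂ}
    (hz : z ∈ A) (hz' : z' ∈ A) :
    rectWind f a b c d (f z) = rectWind f a b c d (f z') := by
  refine hA.induction₂ (fun u v => rectWind f a b c d (f u) = rectWind f a b c d (f v)) ?_
    (fun _ _ _ _ _ _ => Eq.trans) (fun _ _ _ _ => Eq.symm) hz hz'
  intro x hx
  have hne : ∀ w ∈ rectBd a b c d, f w ≠ f x := by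
    intro w hw h
    rw [hinj (hs hw) (hAD hx) h] at hw
    exact disjoint_left.1 hdisj hx hw
  have hc : ContinuousAt f x := hf.continuousOn.continuousAt (hD.mem_nhds (hAD hx))
  filter_upwards [nhdsWithin_le_nhds
    (hc.eventually (rectWind_eventually_eq hab hcd hD hf hs hne))] with y hy using hy.symm

lemma rectWind_self_ne_zero (hD : IsOpen D) (hf : DifferentiableOn ℂ f D) (hinj : InjOn f D)
    (hs : Icc a b ×ℂ Icc c d ⊆ D) {z : ℂ} (h1 : a < z.re) (h2 : z.re < b) (h3 : c < z.im)
    (h4 : z.im < d) (hz : deriv f z ≠ 0) : rectWind f a b c d (f z) ≠ 0 := by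
  have hab : a ≤ b := by linarith
  have hcd : c ≤ d := by linarith
  have hzD : z ∈ D := hs ⟨⟨h1.le, h2.le⟩, ⟨h3.le, h4.le⟩⟩
  have hbd : rectBd a b c d ⊆ D := fun w hw => hs ⟨hw.1, hw.2.1⟩
  have hne : ∀ w ∈ rectBd a b c d, w ≠ z := by
    rintro w ⟨-, -, h⟩ h0
    subst h0
    rcases h with h | h | h | h <;> linarith
  have hF : DifferentiableOn ℂ (dslope f z) D :=
    (differentiableOn_dslope (hD.mem_nhds hzD)).2 hf
  have hF0 : ∀ w ∈ D, dslope f z w ≠ 0 := by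
    intro w hw
    by_cases hwz : w = z
    · rw [hwz, dslope_same]; exact hz
    · rw [dslope_of_ne _ hwz, slope_def_field]
      exact div_ne_zero (sub_ne_zero.2 fun h => hwz (hinj hw hzD h)) (sub_ne_zero.2 hwz)
  have hq : DifferentiableOn ℂ (fun w => deriv (dslope f z) w / dslope f z w) D :=
    (hF.deriv hD).div hF hF0
  have hc : ContinuousOn (fun w => (w - z)⁻¹) (rectBd a b c d) :=
    (continuousOn_id.sub continuousOn_const).inv₀ fun w hw => sub_ne_zero.2 (hne w hw)
  have : rectWind f a b c d (f z) = rectInt (fun w => (w - z)⁻¹) a b c d := by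
    rw [rectWind, rectInt_congr (H := fun w => (w - z)⁻¹ + deriv (dslope f z) w / dslope f z w)
      hab hcd, rectInt_add hab hcd hc (hq.continuousOn.mono hbd),
      rectInt_eq_zero_of_differentiableOn hab hcd (hq.mono hs), add_zero]
    intro w hw
    have hwD := hbd hw
    have hwz : w - z ≠ 0 := sub_ne_zero.2 (hne w hw)
    have hdF : HasDerivAt (dslope f z) (deriv (dslope f z) w) w :=
      (hF.differentiableAt (hD.mem_nhds hwD)).hasDerivAt
    have hmul : HasDerivAt (fun w => (w - z) * dslope f z w)
        (1 * dslope f z w + (w - z) * deriv (dslope f z) w) w :=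
      ((hasDerivAt_id w).sub_const z).mul hdF
    have hfe : f = fun w => f z + (w - z) * dslope f z w := by
      ext u
      rw [← smul_eq_mul, sub_smul_dslope]
      ring
    have hdf : deriv f w = 1 * dslope f z w + (w - z) * deriv (dslope f z) w := by
      refine HasDerivAt.deriv ?_
      conv => rw [hfe]
      have := hmul.const_add (f z)
      convert! this using 1
      rw [← hfe]
    have hfw : f w - f z = (w - z) * dslope f z w := by
      rw [← smul_eq_mul, sub_smul_dslope]
    have := hF0 w hwD
    simp only
    rw [hdf, hfw]
    field_simp
  rw [this]
  exact rectInt_inv_ne_zero h1 h2 h3 h4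

end RectWind

/-- The closed horizontal segment `[xl, xr] + i y`. -/
def slitSeg (y xl xr : ℝ) : Set ℂ := {z : ℂ | z.im = y ∧ z.re ∈ Icc xl xr}

lemma isCompact_slitSeg (y xl xr : ℝ) : IsCompact (slitSeg y xl xr) := by
  have : slitSeg y xl xr = Icc xl xr ×ℂ {y} := by
    ext z; simp [slitSeg, mem_reProdIm, and_comm]
  rw [this]
  exact isCompact_Icc.reProdIm isCompact_singleton

lemma isOpen_UHP : IsOpen UHP := isOpen_lt continuous_const continuous_im

section SlitHalfPlane

variable {D : Set ℂ}

lemma IsParallelSlitHalfPlane.subset_UHP (h : IsParallelSlitHalfPlane D) : D ⊆ UHP := by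
  obtain ⟨N, C, -, -, rfl⟩ := h
  exact sdiff_subset

lemma IsParallelSlitHalfPlane.isOpen (h : IsParallelSlitHalfPlane D) : IsOpen D := by
  obtain ⟨N, C, hC, -, rfl⟩ := h
  refine isOpen_UHP.sdiff (isClosed_iUnion_of_finite fun j => ?_)
  obtain ⟨y, xl, xr, -, -, h⟩ := hC j
  rw [h]
  exact (isCompact_slitSeg y xl xr).isClosed

/-- All slits lie at finitely many heights. -/
lemma IsParallelSlitHalfPlane.exists_heights (h : IsParallelSlitHalfPlane D) :
    ∃ S : Set ℝ, S.Finite ∧ ∀ z ∈ UHP, z ∉ D → z.im ∈ S := by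
  obtain ⟨N, C, hC, -, rfl⟩ := h
  choose y xl xr h0 h1 h2 using hC
  refine ⟨range y, finite_range y, fun z hz hzD => ?_⟩
  have : z ∈ ⋃ j, C j := by
    by_contra h
    exact hzD ⟨hz, h⟩
  obtain ⟨j, hj⟩ := mem_iUnion.1 this
  rw [h2 j] at hj
  exact ⟨j, hj.1.symm⟩

/-- The slits are bounded. -/
lemma IsParallelSlitHalfPlane.exists_bound (h : IsParallelSlitHalfPlane D) :
    ∃ R : ℝ, 0 < R ∧ ∀ z ∈ UHP, z ∉ D → |z.re| ≤ R ∧ z.im ≤ R := by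
  obtain ⟨N, C, hC, -, rfl⟩ := h
  have hb : IsBounded (⋃ j, C j) := by
    refine isBounded_iUnion.2 fun j => ?_
    obtain ⟨y, xl, xr, -, -, h⟩ := hC j
    rw [h]
    exact (isCompact_slitSeg y xl xr).isBounded
  obtain ⟨R, hR, hb⟩ := hb.exists_pos_norm_le
  refine ⟨R, hR, fun z hz hzD => ?_⟩
  have : z ∈ ⋃ j, C j := by
    by_contra h
    exact hzD ⟨hz, h⟩
  exact ⟨(abs_re_le_norm z).trans (hb z this),
    (le_abs_self _).trans ((abs_im_le_norm z).trans (hb z this))⟩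

/-- Every slit has a rectangular neighbourhood free of other slits. -/
lemma IsParallelSlitHalfPlane.exists_rect (h : IsParallelSlitHalfPlane D) {p : ℂ} (hp : p ∈ UHP)
    (hpD : p ∉ D) : ∃ y xl xr ε : ℝ, 0 < ε ∧ ε < y ∧ xl < xr ∧ p ∈ slitSeg y xl xr ∧
      Disjoint (slitSeg y xl xr) D ∧
      (Icc (xl - ε) (xr + ε) ×ℂ Icc (y - ε) (y + ε)) \ slitSeg y xl xr ⊆ D := by
  obtain ⟨N, C, hC, hdisj, rfl⟩ := h
  choose y xl xr h0 h1 h2 using hC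
  replace h2 : ∀ j, C j = slitSeg (y j) (xl j) (xr j) := h2
  have : p ∈ ⋃ j, C j := by
    by_contra h
    exact hpD ⟨hp, h⟩
  obtain ⟨j, hj⟩ := mem_iUnion.1 this
  have hcl : IsClosed (⋃ k : {k // k ≠ j}, C k) := isClosed_iUnion_of_finite fun k => by
    rw [h2]; exact (isCompact_slitSeg _ _ _).isClosed
  have hsub : C j ⊆ (⋃ k : {k // k ≠ j}, C k)ᶜ := by
    intro z hz hz'
    obtain ⟨⟨k, hk⟩, hzk⟩ := mem_iUnion.1 hz'
    exact disjoint_left.1 (hdisj hk) hzk hz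
  have hCj : IsCompact (C j) := by rw [h2]; exact isCompact_slitSeg _ _ _
  obtain ⟨δ, hδ, hth⟩ := hCj.exists_thickening_subset_open hcl.isOpen_compl hsub
  refine ⟨y j, xl j, xr j, min (y j / 2) (δ / 3), lt_min (half_pos (h0 j)) (by positivity),
    (min_le_left _ _).trans_lt (half_lt_self (h0 j)), h1 j, h2 j ▸ hj, ?_, ?_⟩
  · rw [← h2]
    exact disjoint_left.2 fun z hz hz' => hz'.2 (mem_iUnion_of_mem j hz)
  set ε := min (y j / 2) (δ / 3)
  have hε1 : ε ≤ y j / 2 := min_le_left _ _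
  have hε2 : ε ≤ δ / 3 := min_le_right _ _
  rintro z ⟨⟨hzr, hzi⟩, hzs⟩
  simp only [mem_preimage, mem_Icc] at hzr hzi
  refine ⟨show 0 < z.im by have := h0 j; linarith, fun hz => ?_⟩
  obtain ⟨k, hk⟩ := mem_iUnion.1 hz
  by_cases hkj : k = j
  · rw [hkj, h2] at hk
    exact hzs hk
  · refine hth (Metric.mem_thickening_iff.2
      ⟨⟨max (xl j) (min z.re (xr j)), y j⟩, ?_, ?_⟩) (mem_iUnion_of_mem ⟨k, hkj⟩ hk)
    · rw [h2]
      exact ⟨rfl, le_max_left _ _, max_le (h1 j).le (min_le_right _ _)⟩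
    · rw [dist_eq_norm]
      refine (norm_le_abs_re_add_abs_im _).trans_lt ?_
      have e1 : |z.re - max (xl j) (min z.re (xr j))| ≤ δ / 3 := by
        have := (h1 j).le
        rw [abs_le]
        rcases le_total z.re (xr j) with h | h
        · rw [min_eq_left h]
          rcases le_total (xl j) z.re with h' | h'
          · rw [max_eq_right h']; constructor <;> linarith
          · rw [max_eq_left h']; constructor <;> linarith
        · rw [min_eq_right h, max_eq_right this]; constructor <;> linarith
      have e2 : |z.im - y j| ≤ δ / 3 := by
        rw [abs_le]; constructor <;> linarith
      simp only [sub_re, sub_im]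
      linarith

lemma convex_im_eq (h : ℝ) : Convex ℝ {z : ℂ | z.im = h} :=
  convex_hyperplane (IsLinearMap.mk (fun _ _ => rfl) (fun c z => by simp)) h

lemma convex_re_gt_inter_UHP (R : ℝ) : Convex ℝ ({z : ℂ | R < z.re} ∩ UHP) :=
  (convex_halfSpace_re_gt R).inter (convex_halfSpace_im_gt 0)

lemma Set.Finite.exists_notMem_Ioo {S : Set ℝ} (hS : S.Finite) {a b : ℝ} (h : a < b) :
    ∃ x ∈ Ioo a b, x ∉ S := by
  by_contra! h'
  exact (Ioo_infinite h) (hS.subset h')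

lemma IsParallelSlitHalfPlane.isPreconnected (h : IsParallelSlitHalfPlane D) :
    IsPreconnected D := by
  obtain ⟨S, hS, hSD⟩ := h.exists_heights
  obtain ⟨R, hR, hRD⟩ := h.exists_bound
  refine isPreconnected_of_forall (⟨R + 1, 1⟩ : ℂ) fun z hz => ?_
  obtain ⟨r, hr, hball⟩ := Metric.isOpen_iff.1 h.isOpen z hz
  have hz0 : 0 < z.im := h.subset_UHP hz
  obtain ⟨k, ⟨hk1, hk2⟩, hkS⟩ := hS.exists_notMem_Ioo (lt_add_of_pos_right z.im hr)
  have hk0 : 0 < k := hz0.trans hk1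
  refine ⟨ball z r ∪ ({w : ℂ | w.im = k} ∪ ({w : ℂ | R < w.re} ∩ UHP)),
    union_subset hball (union_subset ?_ ?_), Or.inr (Or.inr ⟨?_, ?_⟩),
    Or.inl (mem_ball_self hr), ?_⟩
  · intro w hw
    by_contra hwD
    have hw' : w.im = k := hw
    exact hkS (hw' ▸ hSD w (show 0 < w.im by rw [hw']; exact hk0) hwD)
  · rintro w ⟨hw, hw0⟩
    by_contra hwD
    exact absurd (le_of_abs_le (hRD w hw0 hwD).1) (not_le.2 hw)
  · show R < R + 1
    linarith
  · show (0 : ℝ) < 1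
    exact one_pos
  · refine (convex_ball z r).isPreconnected.union ⟨z.re, k⟩ ?_ (Or.inl rfl)
      ((convex_im_eq k).isPreconnected.union ⟨R + 1, k⟩ rfl
        ⟨show R < R + 1 by linarith, hk0⟩ (convex_re_gt_inter_UHP R).isPreconnected)
    rw [mem_ball, dist_eq_norm]
    refine (norm_le_abs_re_add_abs_im _).trans_lt ?_
    simp only [sub_re, sub_im, sub_self, abs_zero, zero_add]
    rw [abs_lt]; constructor <;> linarith

end SlitHalfPlane

/-- The open `ε`-rectangle around the segment `slitSeg y xl xr`, with the segment removed. -/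
def slitRing (y xl xr ε : ℝ) : Set ℂ :=
  (Ioo (xl - ε) (xr + ε) ×ℂ Ioo (y - ε) (y + ε)) \ slitSeg y xl xr

lemma slitRing_mono {y xl xr ε ε' : ℝ} (h : ε ≤ ε') : slitRing y xl xr ε ⊆ slitRing y xl xr ε' :=
  sdiff_subset_sdiff_left fun _ hz =>
    ⟨Ioo_subset_Ioo (by linarith) (by linarith) hz.1, Ioo_subset_Ioo (by linarith) (by linarith) hz.2⟩

lemma convex_reProdIm {s t : Set ℝ} (hs : Convex ℝ s) (ht : Convex ℝ t) : Convex ℝ (s ×ℂ t) :=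
  (hs.linear_preimage reLm).inter (ht.linear_preimage imLm)

lemma isPreconnected_slitRing {y xl xr ε : ℝ} (hx : xl ≤ xr) (hε : 0 < ε) :
    IsPreconnected (slitRing y xl xr ε) := by
  have hε2 : 0 < ε / 2 := half_pos hε
  have e : slitRing y xl xr ε =
      ((Ioo (xl - ε) (xr + ε) ×ℂ Ioo y (y + ε) ∪ Ioo (xl - ε) xl ×ℂ Ioo (y - ε) (y + ε)) ∪
        Ioo (xl - ε) (xr + ε) ×ℂ Ioo (y - ε) y) ∪ Ioo xr (xr + ε) ×ℂ Ioo (y - ε) (y + ε) := by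
    ext z
    simp only [slitRing, slitSeg, Set.mem_sdiff, mem_union, mem_reProdIm, mem_ofPred_eq, mem_Ioo,
      mem_Icc, not_and, not_le]
    constructor
    · rintro ⟨⟨⟨h1, h2⟩, h3, h4⟩, h5⟩
      rcases lt_trichotomy z.im y with h | h | h
      · exact Or.inl (Or.inr ⟨⟨h1, h2⟩, h3, h⟩)
      · rcases lt_or_ge z.re xl with h6 | h6
        · exact Or.inl (Or.inl (Or.inr ⟨⟨h1, h6⟩, h3, h4⟩))
        · exact Or.inr ⟨⟨h5 h h6, h2⟩, h3, h4⟩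
      · exact Or.inl (Or.inl (Or.inl ⟨⟨h1, h2⟩, h, h4⟩))
    · rintro (((⟨⟨h1, h2⟩, h3, h4⟩ | ⟨⟨h1, h2⟩, h3, h4⟩) | ⟨⟨h1, h2⟩, h3, h4⟩) |
        ⟨⟨h1, h2⟩, h3, h4⟩)
      · exact ⟨⟨⟨h1, h2⟩, by linarith, h4⟩, fun h => absurd h h3.ne'⟩
      · exact ⟨⟨⟨h1, by linarith⟩, h3, h4⟩, fun _ h => absurd h (not_le.2 h2)⟩
      · exact ⟨⟨⟨h1, h2⟩, h3, by linarith⟩, fun h => absurd h h4.ne⟩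
      · exact ⟨⟨⟨by linarith, h2⟩, h3, h4⟩, fun _ _ => h1⟩
  rw [e]
  refine (((convex_reProdIm (convex_Ioo _ _) (convex_Ioo _ _)).isPreconnected.union
    ⟨xl - ε / 2, y + ε / 2⟩ ?_ ?_
    (convex_reProdIm (convex_Ioo _ _) (convex_Ioo _ _)).isPreconnected).union
    ⟨xl - ε / 2, y - ε / 2⟩ (mem_union_right _ ?_) ?_
    (convex_reProdIm (convex_Ioo _ _) (convex_Ioo _ _)).isPreconnected).union
    ⟨xr + ε / 2, y - ε / 2⟩ (mem_union_right _ ?_) ?_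
    (convex_reProdIm (convex_Ioo _ _) (convex_Ioo _ _)).isPreconnected <;>
  refine ⟨⟨?_, ?_⟩, ⟨?_, ?_⟩⟩ <;> dsimp only <;> linarith

section SlitBoundary

variable {D : Set ℂ} {f : ℂ → ℂ}

/-- Local form of the open mapping theorem for injective holomorphic functions. -/
lemma image_mem_nhds_of_injOn (hD : IsOpen D) (hf : DifferentiableOn ℂ f D) (hinj : InjOn f D)
    {z : ℂ} (hz : z ∈ D) {N : Set ℂ} (hN : N ∈ 𝓝 z) : f '' N ∈ 𝓝 (f z) := by
  rcases (hf.analyticAt (hD.mem_nhds hz)).eventually_constant_or_nhds_le_map_nhds with h | h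
  · have h' : ∀ᶠ w in 𝓝[≠] z, f w = f z ∧ w ∈ D :=
      nhdsWithin_le_nhds (h.and (hD.mem_nhds hz))
    obtain ⟨w, ⟨hw1, hw2⟩, hw3⟩ := (h'.and self_mem_nhdsWithin).exists
    exact absurd (hinj hw2 hz hw1) hw3
  · exact h (image_mem_map hN)

lemma exists_deriv_ne_zero (hf : DifferentiableOn ℂ f D) (hinj : InjOn f D)
    {N : Set ℂ} (hN : IsOpen N) (hND : N ⊆ D) (hne : N.Nonempty) :
    ∃ z ∈ N, deriv f z ≠ 0 := by
  by_contra! h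
  obtain ⟨z, hz⟩ := hne
  obtain ⟨r, hr, hball⟩ := Metric.isOpen_iff.1 hN z hz
  have hw : (z + (r / 2 : ℝ)) ∈ ball z r := by
    rw [mem_ball_iff_norm, add_sub_cancel_left, norm_real, Real.norm_eq_abs, abs_of_pos] <;>
      linarith
  have := isOpen_ball.is_const_of_deriv_eq_zero (convex_ball z r).isPreconnected
    (hf.mono (hball.trans hND)) (fun w hw => h w (hball hw)) (mem_ball_self hr) hw
  have := hinj (hND hz) (hND (hball hw)) this
  simp [hr.ne'] at this

lemma SatisfiesH1.exists_norm_gt (h : SatisfiesH1 D f) (R M : ℝ) :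
    ∃ z : ℂ, R < z.re ∧ 0 < z.im ∧ M < ‖f z‖ := by
  obtain ⟨η, hη, -, hlim⟩ := h
  have htop : Tendsto (fun x : ℝ => (⟨x, η + 1⟩ : ℂ)) atTop (cobounded ℂ ⊓ 𝓟 (HP η)) := by
    refine tendsto_inf.2 ⟨?_, tendsto_principal.2 (Eventually.of_forall fun x => ?_)⟩
    · rw [← tendsto_norm_atTop_iff_cobounded]
      exact tendsto_atTop_mono (fun x => (le_abs_self x).trans (abs_re_le_norm (⟨x, η + 1⟩ : ℂ)))
        tendsto_id
    · show η < η + 1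
      linarith
  have := (hlim.comp htop).norm
  rw [norm_zero] at this
  obtain ⟨x, hx1, hx2, hx3⟩ := ((this.eventually (gt_mem_nhds one_pos)).and
    ((eventually_gt_atTop R).and (eventually_gt_atTop (M + 1)))).exists
  refine ⟨⟨x, η + 1⟩, hx2, by positivity, ?_⟩
  have h1 : x ≤ ‖(⟨x, η + 1⟩ : ℂ)‖ :=
    (le_abs_self x).trans (abs_re_le_norm (⟨x, η + 1⟩ : ℂ))
  have h2 := norm_sub_norm_le (⟨x, η + 1⟩ : ℂ) (f ⟨x, η + 1⟩)
  rw [norm_sub_rev] at h2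
  simp only [Function.comp_apply] at hx1
  linarith

lemma rectBd_disjoint_slitRing {y xl xr ε : ℝ} :
    Disjoint (slitRing y xl xr ε) (rectBd (xl - ε) (xr + ε) (y - ε) (y + ε)) := by
  refine disjoint_left.2 ?_
  rintro z ⟨⟨h1, h2⟩, -⟩ ⟨-, -, h | h | h | h⟩ <;>
    simp only [mem_preimage, mem_Ioo, h, lt_self_iff_false, false_and, and_false] at h1 h2

lemma rectBd_subset_of_ring {y xl xr ε : ℝ} (hε : 0 < ε)
    (hring : (Icc (xl - ε) (xr + ε) ×ℂ Icc (y - ε) (y + ε)) \ slitSeg y xl xr ⊆ D) :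
    rectBd (xl - ε) (xr + ε) (y - ε) (y + ε) ⊆ D := by
  rintro z ⟨h1, h2, h⟩
  refine hring ⟨⟨h1, h2⟩, fun ⟨h3, h4, h5⟩ => ?_⟩
  rcases h with h | h | h | h <;> linarith

/-- The image of a ring around a slit winds around the image of the slit. -/
lemma exists_rectWind_ring (hsl : IsParallelSlitHalfPlane D) (hf : DifferentiableOn ℂ f D)
    (hinj : InjOn f D) (h1 : SatisfiesH1 D f) {y xl xr ε : ℝ} (hε : 0 < ε) (hεy : ε < y)
    (hx : xl < xr)
    (hring : (Icc (xl - ε) (xr + ε) ×ℂ Icc (y - ε) (y + ε)) \ slitSeg y xl xr ⊆ D) :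
    ∃ κ : ℂ, κ ≠ 0 ∧ ∀ z ∈ slitRing y xl xr ε,
      rectWind f (xl - ε) (xr + ε) (y - ε) (y + ε) (f z) = κ := by
  have hD := hsl.isOpen
  obtain ⟨S, hS, hSD⟩ := hsl.exists_heights
  obtain ⟨R, hR, hRD⟩ := hsl.exists_bound
  set b := xr + ε / 2 with hb
  have hyy : y - ε ≤ y + ε := by linarith
  obtain ⟨y₂, hy₂, hy₂S⟩ := hS.exists_notMem_Ioo (show y - ε < y + ε by linarith)
  have hclosed : Icc b (xr + ε) ×ℂ Icc (y - ε) (y + ε) ⊆ D := by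
    rintro z ⟨hz1, hz2⟩
    refine hring ⟨⟨⟨?_, hz1.2⟩, hz2⟩, fun h => ?_⟩
    · exact le_trans (by linarith) hz1.1
    · have := hz1.1; have := h.2.2; linarith
  obtain ⟨z₁, ⟨⟨⟨hz1, hz2⟩, hz3, hz4⟩, hz5⟩, hz6⟩ := exists_deriv_ne_zero hf hinj
    (N := (Ioo b (xr + ε) ×ℂ Ioo (y - ε) (y + ε)) ∩ im ⁻¹' Sᶜ)
    ((isOpen_Ioo.reProdIm isOpen_Ioo).inter (hS.isClosed.isOpen_compl.preimage continuous_im))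
    (fun z hz => hclosed ⟨Ioo_subset_Icc_self hz.1.1, Ioo_subset_Icc_self hz.1.2⟩)
    ⟨⟨xr + 3 * ε / 4, y₂⟩, ⟨⟨by simp only [hb]; linarith, by simp only; linarith⟩, hy₂⟩, hy₂S⟩
  have hbd := rectBd_subset_of_ring hε hring
  have hz₁R : z₁ ∈ slitRing y xl xr ε :=
    ⟨⟨⟨by linarith, hz2⟩, ⟨hz3, hz4⟩⟩, fun h => by have := h.2.2; linarith⟩
  have hbdQ : rectBd (xl - ε) b (y - ε) (y + ε) ⊆ D := by
    rintro z ⟨h1, h2, h⟩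
    refine hring ⟨⟨⟨h1.1, h1.2.trans (by linarith)⟩, h2⟩, fun ⟨h3, h4, h5⟩ => ?_⟩
    rcases h with h | h | h | h <;> linarith
  have hbdS : rectBd b (xr + ε) (y - ε) (y + ε) ⊆ D := fun z hz => hclosed ⟨hz.1, hz.2.1⟩
  -- the part of the rectangle around the slit does not wind around `f z₁`
  have hQ : rectWind f (xl - ε) b (y - ε) (y + ε) (f z₁) = 0 := by
    have hAD : {w : ℂ | w.im = z₁.im} ∩ {w : ℂ | b < w.re} ∪ {w : ℂ | max R b < w.re} ∩ UHP ⊆ D := by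
      rintro w (⟨hw1, -⟩ | ⟨hw1, hw2⟩)
      · by_contra hwD
        have hw1 : w.im = z₁.im := hw1
        exact hz5 (hw1 ▸ hSD w (show 0 < w.im by rw [hw1]; linarith) hwD)
      · by_contra hwD
        exact absurd (le_of_abs_le (hRD w hw2 hwD).1) (not_le.2 ((le_max_left R b).trans_lt hw1))
    have hA : IsPreconnected
        ({w : ℂ | w.im = z₁.im} ∩ {w : ℂ | b < w.re} ∪ {w : ℂ | max R b < w.re} ∩ UHP) := by
      refine ((convex_im_eq _).inter (convex_halfSpace_re_gt _)).isPreconnected.union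
        ⟨max R b + 1, z₁.im⟩ ⟨rfl, ?_⟩ ⟨?_, ?_⟩ (convex_re_gt_inter_UHP _).isPreconnected
      · exact (le_max_right R b).trans_lt (lt_add_one _)
      · exact lt_add_one (max R b)
      · show 0 < z₁.im
        linarith
    have hdisj : Disjoint
        ({w : ℂ | w.im = z₁.im} ∩ {w : ℂ | b < w.re} ∪ {w : ℂ | max R b < w.re} ∩ UHP)
        (rectBd (xl - ε) b (y - ε) (y + ε)) := by
      refine disjoint_left.2 ?_
      rintro w hw ⟨⟨-, hw1⟩, -⟩
      rcases hw with ⟨-, hw⟩ | ⟨hw, -⟩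
      · exact absurd hw1 (not_le.2 hw)
      · exact absurd hw1 (not_le.2 ((le_max_right R b).trans_lt hw))
    obtain ⟨M, hM⟩ := isCompact_rectBd.exists_bound_of_continuousOn (hf.continuousOn.mono hbdQ)
    obtain ⟨w, hw1, hw2, hw3⟩ := h1.exists_norm_gt (max R b) M
    rw [rectWind_eq_on_preconnected (by linarith) hyy hD hf hinj hbdQ hA hAD hdisj
      (Or.inl ⟨rfl, hz1⟩) (Or.inr ⟨hw1, hw2⟩)]
    exact rectWind_eq_zero_of_norm_lt (by linarith) hyy hD hf hbdQ
      fun u hu => (hM u hu).trans_lt hw3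
  refine ⟨rectWind f (xl - ε) (xr + ε) (y - ε) (y + ε) (f z₁), ?_, fun z hz => ?_⟩
  · have hadd : rectWind f (xl - ε) (xr + ε) (y - ε) (y + ε) (f z₁) =
        rectWind f (xl - ε) b (y - ε) (y + ε) (f z₁) +
        rectWind f b (xr + ε) (y - ε) (y + ε) (f z₁) := by
      refine rectInt_add_adjacent (by linarith) (by linarith) hyy
        (continuousOn_logDeriv_sub hD hf hbdQ fun w hw h => ?_)
        (continuousOn_logDeriv_sub hD hf hbdS fun w hw h => ?_)
      · have e := hinj (hbdQ hw) (hclosed ⟨⟨hz1.le, hz2.le⟩, hz3.le, hz4.le⟩) h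
        have := hw.1.2
        rw [e] at this
        linarith
      · have e := hinj (hbdS hw) (hclosed ⟨⟨hz1.le, hz2.le⟩, hz3.le, hz4.le⟩) h
        have := hw.2.2
        rw [e] at this
        rcases this with h | h | h | h <;> linarith
    rw [hadd, hQ, zero_add]
    exact rectWind_self_ne_zero hD hf hinj hclosed hz1 hz2 hz3 hz4 hz6
  · exact rectWind_eq_on_preconnected (by linarith) hyy hD hf hinj hbd
      (isPreconnected_slitRing hx.le hε)
      (fun w hw => hring ⟨⟨Ioo_subset_Icc_self hw.1.1, Ioo_subset_Icc_self hw.1.2⟩, hw.2⟩)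
      rectBd_disjoint_slitRing hz hz₁R

end SlitBoundary

section SlitLimit

variable {D G : Set ℂ} {f : ℂ → ℂ}

/-- Cluster values of a univalent map along a slit avoid its image but belong to any simply
connected domain containing the image. -/
lemma mem_of_mem_closure_image_slitRing (hsl : IsParallelSlitHalfPlane D)
    (hf : DifferentiableOn ℂ f D) (hinj : InjOn f D) (hGo : IsOpen G)
    (hG : IsSimplyConnected G) (hmaps : MapsTo f D G) {y xl xr ε : ℝ} (hε : 0 < ε)
    (hx : xl < xr) (hdisj : Disjoint (slitSeg y xl xr) D)
    (hring : (Icc (xl - ε) (xr + ε) ×ℂ Icc (y - ε) (y + ε)) \ slitSeg y xl xr ⊆ D)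
    {κ : ℂ} (hκ : κ ≠ 0) (hW : ∀ z ∈ slitRing y xl xr ε,
      rectWind f (xl - ε) (xr + ε) (y - ε) (y + ε) (f z) = κ)
    {q : ℂ} (hq : ∀ e, 0 < e → e ≤ ε → q ∈ closure (f '' slitRing y xl xr e)) :
    q ∈ G ∧ q ∉ f '' D := by
  have hD := hsl.isOpen
  have hxx : xl - ε ≤ xr + ε := by linarith
  have hyy : y - ε ≤ y + ε := by linarith
  have hbd := rectBd_subset_of_ring hε hring
  have hringD : slitRing y xl xr ε ⊆ D := fun w hw =>
    hring ⟨⟨Ioo_subset_Icc_self hw.1.1, Ioo_subset_Icc_self hw.1.2⟩, hw.2⟩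
  have hqD : q ∉ f '' D := by
    rintro ⟨z, hz, rfl⟩
    have hzs : z ∉ slitSeg y xl xr := fun h => disjoint_left.1 hdisj h hz
    obtain ⟨e, he0, heε, hN⟩ : ∃ e, 0 < e ∧ e ≤ ε ∧ (slitRing y xl xr e)ᶜ ∈ 𝓝 z := by
      -- a closed rectangle around the slit avoiding `z`
      obtain ⟨e, he, hez⟩ : ∃ e, 0 < e ∧
          z ∉ Icc (xl - e) (xr + e) ×ℂ Icc (y - e) (y + e) := by
        by_contra! h
        refine hzs ⟨le_antisymm ?_ ?_, ?_, ?_⟩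
        · exact le_of_forall_pos_le_add fun e he => (h e he).2.2
        · exact le_of_forall_pos_le_add fun e he => by have := (h e he).2.1; linarith
        · exact le_of_forall_pos_le_add fun e he => by have := (h e he).1.1; linarith
        · exact le_of_forall_pos_le_add fun e he => (h e he).1.2
      refine ⟨min e ε, lt_min he hε, min_le_right _ _, ?_⟩
      refine mem_of_superset ((isClosed_Icc.reProdIm isClosed_Icc).isOpen_compl.mem_nhds hez) ?_
      refine compl_subset_compl.2 fun w hw => ?_
      have := slitRing_mono (min_le_left e ε) hw
      exact ⟨Ioo_subset_Icc_self this.1.1, Ioo_subset_Icc_self this.1.2⟩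
    have hfN := image_mem_nhds_of_injOn hD hf hinj hz (inter_mem hN (hD.mem_nhds hz))
    obtain ⟨_, ⟨w, ⟨hw1, hwD⟩, rfl⟩, ⟨w', hw', he'⟩⟩ :=
      mem_closure_iff_nhds.1 (hq e he0 heε) _ hfN
    have := hinj (hringD (slitRing_mono heε hw')) hwD he'
    exact hw1 (this ▸ hw')
  refine ⟨?_, hqD⟩
  have hne : ∀ w ∈ rectBd (xl - ε) (xr + ε) (y - ε) (y + ε), f w ≠ q :=
    fun w hw h => hqD ⟨w, hbd hw, h⟩
  obtain ⟨_, hw, ⟨w', hw', rfl⟩⟩ := mem_closure_iff_nhds.1 (hq ε hε le_rfl) _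
    (rectWind_eventually_eq hxx hyy hD hf hbd hne)
  have hWq : rectWind f (xl - ε) (xr + ε) (y - ε) (y + ε) q = κ := by
    rw [← hW w' hw']
    exact Eq.symm hw
  by_contra hqG
  obtain ⟨ℓ, hℓ, hexp⟩ := exists_continuousOn_eqOn_exp_comp hG hGo
    (g := fun w => w - q) (by fun_prop) (by
      rintro ⟨w, hw, h⟩
      exact hqG (sub_eq_zero.1 h ▸ hw))
  refine hκ (hWq ▸ rectWind_eq_zero_of_exp_eq (L := ℓ ∘ f) hxx hyy hD hf hbd
    (hℓ.comp hf.continuousOn hmaps) fun w hw => hexp (hmaps hw))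

/-- If the complement of the image of a slit half-plane in a simply connected domain lies at
finitely many heights, then the imaginary part of the map has a limit at every slit point. -/
lemma exists_tendsto_im_slit (hsl : IsParallelSlitHalfPlane D)
    (hf : DifferentiableOn ℂ f D) (hinj : InjOn f D) (h1 : SatisfiesH1 D f) (hGo : IsOpen G)
    (hG : IsSimplyConnected G) (hmaps : MapsTo f D G) {S : Set ℝ} (hS : S.Finite)
    (hGS : ∀ w ∈ G, w ∉ f '' D → w.im ∈ S) {p : ℂ} (hp : p ∈ UHP) (hpD : p ∉ D) :
    ∃ m ∈ S, Tendsto (fun z => (f z).im) (𝓝[D] p) (𝓝 m) := by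
  obtain ⟨y, xl, xr, ε, hε, hεy, hx, hps, hdisj, hring⟩ := hsl.exists_rect hp hpD
  obtain ⟨κ, hκ, hW⟩ := exists_rectWind_ring hsl hf hinj h1 hε hεy hx hring
  have hD := hsl.isOpen
  have hxx : xl - ε ≤ xr + ε := by linarith
  have hyy : y - ε ≤ y + ε := by linarith
  have hbd := rectBd_subset_of_ring hε hring
  have hringD : ∀ e ≤ ε, slitRing y xl xr e ⊆ D := fun e he w hw =>
    have hw := slitRing_mono he hw
    hring ⟨⟨Ioo_subset_Icc_self hw.1.1, Ioo_subset_Icc_self hw.1.2⟩, hw.2⟩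
  have hclus : ∀ q : ℂ, (∀ e, 0 < e → e ≤ ε → q ∈ closure (f '' slitRing y xl xr e)) →
      q.im ∈ S := fun q hq =>
    have := mem_of_mem_closure_image_slitRing hsl hf hinj hGo hG hmaps hε hx hdisj hring hκ hW hq
    hGS q this.1 this.2
  -- the image of the ring is bounded
  obtain ⟨M, hM⟩ := isCompact_rectBd.exists_bound_of_continuousOn (hf.continuousOn.mono hbd)
  have hbdd : ∀ z ∈ slitRing y xl xr ε, ‖f z‖ ≤ M := by
    intro z hz
    by_contra! h
    refine hκ (hW z hz ▸ rectWind_eq_zero_of_norm_lt hxx hyy hD hf hbd fun u hu => ?_)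
    exact (hM u hu).trans_lt h
  have hcpt : IsCompact (closure (f '' slitRing y xl xr ε)) := by
    refine (isBounded_iff_forall_norm_le.2 ⟨M, ?_⟩).isCompact_closure
    rintro _ ⟨z, hz, rfl⟩
    exact hbdd z hz
  set e : ℕ → ℝ := fun n => ε / (n + 1) with he
  have he0 : ∀ n, 0 < e n := fun n => by positivity
  have hanti : Antitone e := fun m n h => by
    simp only [he]
    gcongr
  have heε : ∀ n, e n ≤ ε := fun n => by simpa [he] using hanti (Nat.zero_le n)
  have hcof : ∀ d, 0 < d → ∃ n, e n ≤ d := fun d hd => by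
    obtain ⟨n, hn⟩ := exists_nat_gt (ε / d)
    refine ⟨n, ?_⟩
    rw [div_lt_iff₀ hd] at hn
    simp only [he]
    rw [div_le_iff₀ (by positivity)]
    linarith
  -- nested nonempty closed subsets have a common point, which is a cluster value
  have hnest : ∀ F : Set ℂ, IsClosed F →
      (∀ n, (closure (f '' slitRing y xl xr (e n)) ∩ F).Nonempty) →
      ∃ q ∈ F, ∀ d, 0 < d → d ≤ ε → q ∈ closure (f '' slitRing y xl xr d) := by
    intro F hF hne
    obtain ⟨q, hq⟩ := IsCompact.nonempty_iInter_of_sequence_nonempty_isCompact_isClosed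
      (fun n => closure (f '' slitRing y xl xr (e n)) ∩ F)
      (fun n => inter_subset_inter_left _ (closure_mono (image_mono
        (slitRing_mono (hanti (Nat.le_succ n)))))) hne
      ((hcpt.of_isClosed_subset isClosed_closure
        (closure_mono (image_mono (slitRing_mono (heε 0))))).inter_right hF)
      (fun n => isClosed_closure.inter hF)
    rw [mem_iInter] at hq
    refine ⟨q, (hq 0).2, fun d hd _ => ?_⟩
    obtain ⟨n, hn⟩ := hcof d hd
    exact closure_mono (image_mono (slitRing_mono hn)) (hq n).1
  have hringne : ∀ d, 0 < d → (slitRing y xl xr d).Nonempty := fun d hd =>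
    ⟨⟨xl - d / 2, y⟩, ⟨⟨by dsimp only; linarith, by dsimp only; linarith⟩, by dsimp only; linarith,
      by dsimp only; linarith⟩, fun h => by have := h.2.1; dsimp only at this; linarith⟩
  obtain ⟨q, -, hq⟩ := hnest univ isClosed_univ fun n => by
    rw [inter_univ]
    exact ((hringne _ (he0 n)).image f).closure
  refine ⟨q.im, hclus q hq, ?_⟩
  have hnhds : ∀ d, 0 < d → d ≤ ε → slitRing y xl xr d ∈ 𝓝[D] p := by
    intro d hd hdε
    have h1 : Ioo (xl - d) (xr + d) ×ℂ Ioo (y - d) (y + d) ∈ 𝓝 p := by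
      refine (isOpen_Ioo.reProdIm isOpen_Ioo).mem_nhds ⟨⟨?_, ?_⟩, ?_, ?_⟩
      · have := hps.2.1; linarith
      · have := hps.2.2; linarith
      · have := hps.1; linarith
      · have := hps.1; linarith
    filter_upwards [mem_nhdsWithin_of_mem_nhds h1, self_mem_nhdsWithin] with z hz hzD
    exact ⟨hz, fun h => disjoint_left.1 hdisj h hzD⟩
  by_contra hnot
  rw [Metric.tendsto_nhds] at hnot
  push Not at hnot
  obtain ⟨η, hη, hfreq⟩ := hnot
  obtain ⟨k, ⟨hk0, hkη⟩, hkS⟩ := ((hS.preimage (f := fun k => q.im + k)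
    (add_right_injective q.im).injOn).union (hS.preimage (f := fun k => q.im - k)
    (sub_right_injective).injOn)).exists_notMem_Ioo hη
  obtain ⟨q', hq'F, hq'⟩ := hnest {w | |w.im - q.im| = k}
    (isClosed_eq (by fun_prop) continuous_const) fun n => by
      have hsub := hringD (e n) (heε n)
      obtain ⟨z₁, hz₁, hz₁R⟩ := (hfreq.and_eventually (hnhds (e n) (he0 n) (heε n))).exists
      obtain ⟨_, hz₂, ⟨z₂, hz₂R, rfl⟩⟩ := mem_closure_iff_nhds.1 (hq (e n) (he0 n) (heε n))
        (ball q k) (ball_mem_nhds q hk0)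
      have hc : ContinuousOn (fun z => |(f z).im - q.im|) (slitRing y xl xr (e n)) := by
        have := hf.continuousOn.mono hsub
        fun_prop
      have hk₂ : |(f z₂).im - q.im| ≤ k := by
        rw [mem_ball_iff_norm] at hz₂
        exact ((abs_im_le_norm (f z₂ - q)).trans_lt hz₂).le
      have hk₁ : k ≤ |(f z₁).im - q.im| := by
        rw [Real.dist_eq] at hz₁
        exact hkη.le.trans hz₁
      obtain ⟨z₃, hz₃R, hz₃⟩ := (isPreconnected_slitRing hx.le (he0 n)).intermediate_value
        hz₂R hz₁R hc ⟨hk₂, hk₁⟩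
      exact ⟨f z₃, subset_closure ⟨z₃, hz₃R, rfl⟩, hz₃⟩
  have hmem := hclus q' hq'
  refine hkS ?_
  rcases eq_or_eq_neg_of_abs_eq hq'F with h | h
  · exact Or.inl (show q.im + k ∈ S by rw [← h]; simpa using hmem)
  · refine Or.inr (show q.im - k ∈ S from ?_)
    have : q'.im = q.im - k := by linarith
    rwa [← this]

end SlitLimit

lemma exists_norm_lt_of_tendsto {g : ℂ → ℂ} {η : ℝ}
    (h : Tendsto g (cobounded ℂ ⊓ 𝓟 (HP η)) (𝓝 0)) {e : ℝ} (he : 0 < e) :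
    ∃ R : ℝ, 0 < R ∧ ∀ z : ℂ, R < ‖z‖ → η < z.im → ‖g z‖ < e := by
  have := h.eventually (ball_mem_nhds 0 he)
  rw [eventually_inf_principal] at this
  obtain ⟨R, -, hR⟩ := (hasBasis_cobounded_norm (E := ℂ)).eventually_iff.1 this
  refine ⟨max R 1, by positivity, fun z hz hzη => ?_⟩
  exact mem_ball_zero_iff.1 (hR (show R ≤ ‖z‖ from (le_max_left R 1).trans hz.le) hzη)

lemma tendsto_mul_I_atTop (η : ℝ) :
    Tendsto (fun Y : ℝ => (Y : ℂ) * I) atTop (cobounded ℂ ⊓ 𝓟 (HP η)) := by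
  refine tendsto_inf.2 ⟨?_, tendsto_principal.2 ?_⟩
  · rw [← tendsto_norm_atTop_iff_cobounded]
    exact tendsto_atTop_mono (fun Y => by simpa using le_abs_self Y) tendsto_id
  · filter_upwards [eventually_gt_atTop η] with Y hY
    show η < _
    simpa using hY

/-- A form of the maximum principle: a harmonic function on a slit half-plane which vanishes at
infinity, has finitely many possible limits at the slits and exceeds `- Im z`, is nonnegative. -/
lemma im_nonneg_of_tendsto_slits {D : Set ℂ} {g : ℂ → ℂ} (hsl : IsParallelSlitHalfPlane D)
    (hg : DifferentiableOn ℂ g D) {η : ℝ} (hη : HP η ⊆ D)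
    (hlim : Tendsto g (cobounded ℂ ⊓ 𝓟 (HP η)) (𝓝 0)) {M : Set ℝ} (hM : M.Finite)
    (hslit : ∀ p ∈ UHP, p ∉ D → ∃ m ∈ M, Tendsto (fun z => (g z).im) (𝓝[D] p) (𝓝 m))
    (hlow : ∀ z ∈ D, -z.im < (g z).im) {z : ℂ} (hz : z ∈ D) : 0 ≤ (g z).im := by
  have hD := hsl.isOpen
  have hconn := hsl.isPreconnected
  have hI : ∀ᶠ Y : ℝ in atTop, (Y : ℂ) * I ∈ D := by
    have := (tendsto_inf.1 (tendsto_mul_I_atTop η)).2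
    exact (tendsto_principal.1 this).mono fun Y hY => hη hY
  by_contra! hzneg
  -- choose a negative value which is not a limit value
  obtain ⟨z₀, hz₀, hneg, hz₀M⟩ : ∃ z₀ ∈ D, (g z₀).im < 0 ∧ (g z₀).im ∉ M := by
    rcases (hg.analyticOnNhd hD).is_constant_or_isOpen hconn with ⟨w, hw⟩ | hopen
    · have h0 : Tendsto (fun Y : ℝ => g (Y * I)) atTop (𝓝 w) :=
        tendsto_const_nhds.congr' (hI.mono fun Y hY => (hw _ hY).symm)
      have : w = 0 := tendsto_nhds_unique h0 (hlim.comp (tendsto_mul_I_atTop η))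
      rw [hw z hz, this] at hzneg
      simp at hzneg
    · have := (hopen D subset_rfl hD).mem_nhds ⟨z, hz, rfl⟩
      obtain ⟨r, hr, hball⟩ := Metric.mem_nhds_iff.1 this
      obtain ⟨k, ⟨hk1, hk2⟩, hkM⟩ := hM.exists_notMem_Ioo (show (g z).im - r < (g z).im by linarith)
      have hmem : (⟨(g z).re, k⟩ : ℂ) ∈ ball (g z) r := by
        rw [mem_ball_iff_norm]
        refine (norm_le_abs_re_add_abs_im _).trans_lt ?_
        simp only [sub_re, sub_im, sub_self, abs_zero, zero_add]
        rw [abs_lt]; constructor <;> linarith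
      obtain ⟨z₀, hz₀, he⟩ := hball hmem
      exact ⟨z₀, hz₀, by rw [he]; exact hk2.trans hzneg, by rwa [he]⟩
  obtain ⟨R, hR, hRD⟩ := hsl.exists_bound
  have hlog : ∀ w ∈ UHP, 0 ≤ Real.log ‖w + I‖ := fun w hw => by
    refine Real.log_nonneg (le_trans ?_ (abs_im_le_norm _))
    have hw : 0 < w.im := hw
    rw [add_im, I_im, abs_of_pos (by linarith)]
    linarith
  set B := max (Real.log (2 * R + 1)) (Real.log ‖z₀ + I‖) + 1 with hB
  have hB0 : 0 < B := by
    have := hlog z₀ (hsl.subset_UHP hz₀)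
    have := le_max_right (Real.log (2 * R + 1)) (Real.log ‖z₀ + I‖)
    linarith
  have hBz : Real.log ‖z₀ + I‖ ≤ B := (le_max_right _ _).trans (by linarith)
  have hBp : ∀ p ∈ UHP, p ∉ D → Real.log ‖p + I‖ ≤ B := fun p hp hpD => by
    refine le_trans ?_ ((le_max_left _ _).trans (by linarith : _ ≤ B))
    have h1 := hRD p hp hpD
    have hp' : 0 < p.im := hp
    have h2 : ‖p + I‖ ≤ 2 * R + 1 := by
      refine (norm_add_le _ _).trans ?_
      rw [norm_I]
      have := norm_le_abs_re_add_abs_im p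
      rw [abs_of_pos hp'] at this
      linarith
    refine Real.log_le_log ?_ h2
    refine lt_of_lt_of_le ?_ (abs_im_le_norm _)
    rw [add_im, I_im, abs_of_pos (by linarith)]
    linarith
  obtain ⟨d, hd, hdM⟩ : ∃ d, 0 < d ∧ ∀ m ∈ M, d ≤ |m - (g z₀).im| := by
    obtain ⟨d, hd, hball⟩ := Metric.isOpen_iff.1 hM.isClosed.isOpen_compl _ hz₀M
    refine ⟨d, hd, fun m hm => ?_⟩
    by_contra! h
    exact hball (show m ∈ ball _ _ from h) hm
  set ε := min d (-(g z₀).im) / (2 * B) with hε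
  have hε0 : 0 < ε := div_pos (lt_min hd (by linarith)) (by positivity)
  have hεB : ε * B = min d (-(g z₀).im) / 2 := by rw [hε]; field_simp
  have hεd : ε * B < d := by
    have := min_le_left d (-(g z₀).im); rw [hεB]; linarith
  have hεz : ε * B < -(g z₀).im := by
    have := min_le_right d (-(g z₀).im); rw [hεB]; linarith
  set G : ℂ → ℂ := fun w => g w + ε * I * log (w + I) with hG
  have hGim : ∀ w, (G w).im = (g w).im + ε * Real.log ‖w + I‖ := fun w => by
    simp [hG, log_re]
  have hGd : DifferentiableOn ℂ G D := by
    refine hg.add (DifferentiableOn.const_mul ?_ _)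
    refine DifferentiableOn.clog (by fun_prop) fun w hw => Or.inr ?_
    have : 0 < w.im := hsl.subset_UHP hw
    rw [add_im, I_im]
    linarith
  set v₀ := (G z₀).im with hv₀
  have hv₀neg : v₀ < 0 := by
    rw [hv₀, hGim]
    have := mul_le_mul_of_nonneg_left hBz hε0.le
    linarith
  set L : Set ℂ := {w | w ∈ D ∧ (G w).im = v₀} with hL
  have hLim : ∀ w ∈ L, -v₀ ≤ w.im := fun w hw => by
    have h1 := hlow w hw.1
    have h2 := hGim w
    rw [hw.2] at h2
    have := mul_nonneg hε0.le (hlog w (hsl.subset_UHP hw.1))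
    linarith
  have hLcl : IsClosed L := by
    refine isClosed_of_closure_subset fun p hp => ?_
    have hpim : -v₀ ≤ p.im :=
      closure_minimal hLim (isClosed_le continuous_const continuous_im) hp
    have hpU : p ∈ UHP := show 0 < p.im by linarith
    have hfreq : ∃ᶠ w in 𝓝[D] p, (G w).im = v₀ := by
      rw [mem_closure_iff_frequently] at hp
      rw [frequently_nhdsWithin_iff]
      exact hp.mono fun w hw => ⟨hw.2, hw.1⟩
    have key : ∀ l, Tendsto (fun w => (G w).im) (𝓝[D] p) (𝓝 l) → l = v₀ := fun l hl => by
      by_contra hne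
      exact hfreq (hl.eventually_ne hne)
    by_cases hpD : p ∈ D
    · exact ⟨hpD, key _ ((continuous_im.comp_continuousOn hGd.continuousOn) p hpD)⟩
    · obtain ⟨m, hm, hmt⟩ := hslit p hpU hpD
      have hp1 : ‖p + I‖ ≠ 0 := by
        rw [norm_ne_zero_iff]
        intro h
        have := congrArg im h
        rw [add_im, I_im, zero_im] at this
        linarith
      have hlogt : Tendsto (fun w : ℂ => ε * Real.log ‖w + I‖) (𝓝[D] p)
          (𝓝 (ε * Real.log ‖p + I‖)) := by
        refine Tendsto.mono_left ?_ nhdsWithin_le_nhds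
        have : ContinuousAt (fun w : ℂ => ‖w + I‖) p := by fun_prop
        exact (this.log hp1).const_mul ε
      have h := key _ ((hmt.add hlogt).congr fun w => (hGim w).symm)
      rw [hv₀, hGim] at h
      have h1 := hdM m hm
      have h2 := mul_le_mul_of_nonneg_left (hBp p hpU hpD) hε0.le
      have h3 := mul_le_mul_of_nonneg_left hBz hε0.le
      have h4 := mul_nonneg hε0.le (hlog p hpU)
      have h5 := mul_nonneg hε0.le (hlog z₀ (hsl.subset_UHP hz₀))
      have h6 : |m - (g z₀).im| ≤ ε * B := by
        rw [abs_le]; constructor <;> linarith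
      linarith
  have hLb : IsBounded L := by
    obtain ⟨R', hR', hsmall⟩ := exists_norm_lt_of_tendsto hlim one_pos
    set K := max (max 1 η) R' with hK
    have hK1 : 1 ≤ K := (le_max_left 1 η).trans (le_max_left _ _)
    have hK2 : η ≤ K := (le_max_right 1 η).trans (le_max_left _ _)
    have hK3 : R' ≤ K := le_max_right _ _
    have hvK : ∀ w ∈ D, -K ≤ (g w).im := fun w hw => by
      have h1 := hlow w hw
      by_cases hwη : η < w.im
      · by_cases hwR : R' < ‖w‖
        · have h2 := neg_le_of_abs_le ((abs_im_le_norm (g w)).trans (hsmall w hwR hwη).le)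
          linarith
        · have h2 := (le_abs_self _).trans (abs_im_le_norm w)
          linarith
      · linarith
    refine isBounded_iff_forall_norm_le.2 ⟨Real.exp (K / ε) + 1, fun w hw => ?_⟩
    have h1 := hGim w
    rw [hw.2] at h1
    have h2 := hvK w hw.1
    have h3 : Real.log ‖w + I‖ ≤ K / ε := by
      rw [le_div_iff₀ hε0]
      linarith
    have hwI : 0 < ‖w + I‖ := by
      refine lt_of_lt_of_le ?_ (abs_im_le_norm _)
      have : 0 < w.im := hsl.subset_UHP hw.1
      rw [add_im, I_im, abs_of_pos (by linarith)]
      linarith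
    have h4 := (Real.log_le_iff_le_exp hwI).1 h3
    have h5 := norm_sub_le (w + I) I
    rw [add_sub_cancel_right, norm_I] at h5
    linarith
  obtain ⟨z₁, hz₁, hmax⟩ := (isCompact_of_isClosed_isBounded hLcl hLb).exists_isMaxOn
    ⟨z₀, hz₀, rfl⟩ (continuous_re.comp_continuousOn (hGd.continuousOn.mono fun w hw => hw.1))
  rcases (hGd.analyticOnNhd hD).is_constant_or_isOpen hconn with ⟨w, hw⟩ | hopen
  · have h0 : Tendsto (fun Y : ℝ => (g (Y * I)).im + ε * Real.log ‖(Y : ℂ) * I + I‖) atTop atTop := by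
      have h1 : Tendsto (fun Y : ℝ => (g (Y * I)).im) atTop (𝓝 0) := by
        have := continuous_im.continuousAt.tendsto.comp (hlim.comp (tendsto_mul_I_atTop η))
        simpa [Function.comp_def] using this
      refine h1.add_atTop (Tendsto.const_mul_atTop hε0 (Real.tendsto_log_atTop.comp ?_))
      refine tendsto_atTop_mono (fun Y => ?_) tendsto_id
      refine le_trans ?_ (abs_im_le_norm _)
      simp only [id, add_im, mul_im, ofReal_re, I_im, mul_one, ofReal_im, I_re, mul_zero, add_zero]
      exact le_trans (by linarith) (le_abs_self _)
    have h1 : Tendsto (fun Y : ℝ => (g (Y * I)).im + ε * Real.log ‖(Y : ℂ) * I + I‖) atTop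
        (𝓝 w.im) :=
      tendsto_const_nhds.congr' (hI.mono fun Y hY => by simp only [← hGim, hw _ hY])
    exact not_tendsto_nhds_of_tendsto_atTop h0 _ h1
  · obtain ⟨r, hr, hball⟩ := Metric.mem_nhds_iff.1 ((hopen D subset_rfl hD).mem_nhds ⟨z₁, hz₁.1, rfl⟩)
    have hmem : G z₁ + (r / 2 : ℝ) ∈ ball (G z₁) r := by
      rw [mem_ball_iff_norm, add_sub_cancel_left, norm_real, Real.norm_eq_abs, abs_of_pos] <;>
        linarith
    obtain ⟨z₂, hz₂, he⟩ := hball hmem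
    have h2 : z₂ ∈ L := ⟨hz₂, by rw [he, add_im, ofReal_im, add_zero]; exact hz₁.2⟩
    have h3 : (G z₂).re ≤ (G z₁).re := hmax h2
    rw [he, add_re, ofReal_re] at h3
    linarith

/-- Data for a holomorphic function `g` on a slit half-plane, vanishing at infinity, whose
imaginary part extends to a nonnegative continuous function `V` on the upper half-plane. -/
structure IsSlitPotential (D : Set ℂ) (g : ℂ → ℂ) (V : ℂ → ℝ) (η c : ℝ) : Prop where
  slit : IsParallelSlitHalfPlane D
  holo : DifferentiableOn ℂ g D
  cont : ContinuousOn V UHP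
  eq_im : ∀ z ∈ D, V z = (g z).im
  nonneg : ∀ z ∈ UHP, 0 ≤ V z
  eta_nonneg : 0 ≤ η
  subset : HP η ⊆ D
  lim : Tendsto g (cobounded ℂ ⊓ 𝓟 (HP η)) (𝓝 0)
  res : Tendsto (fun Y : ℝ => Y * (g (Y * I)).im) atTop (𝓝 c)

namespace IsSlitPotential

variable {D : Set ℂ} {g : ℂ → ℂ} {V : ℂ → ℝ} {η c : ℝ}

lemma exists_norm_le_of_abs_re (h : IsSlitPotential D g V η c) {y K ε : ℝ} (hy : 0 < y)
    (hε : 0 < ε) : ∃ X₀ : ℝ, 0 < X₀ ∧ ∀ X : ℝ, X₀ ≤ |X| → ∀ y' ∈ Icc y K,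
      (X + y' * I : ℂ) ∈ D ∧ ‖g (X + y' * I)‖ ≤ ε := by
  obtain ⟨R, hR, hRD⟩ := h.slit.exists_bound
  set K' := max K η + 1 with hK'
  have hKK' : K < K' := (le_max_left K η).trans_lt (by linarith)
  have hηK' : η < K' := (le_max_right K η).trans_lt (by linarith)
  have hK0 : 0 < K' := h.eta_nonneg.trans_lt hηK'
  set M := ε * y / (8 * K') with hM
  have hM0 : 0 < M := by positivity
  obtain ⟨R', hR', hsmall⟩ := exists_norm_lt_of_tendsto h.lim hM0
  refine ⟨R + K' + R' + 1, by positivity, fun X hX y' hy' => ?_⟩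
  have hball : ∀ w ∈ ball (0 : ℂ) K', (X + K' * I : ℂ) + w ∈ D := fun w hw => by
    rw [mem_ball_zero_iff] at hw
    by_contra hD
    have h1 := (abs_le.1 ((abs_im_le_norm w).trans hw.le)).1
    have h1' := (abs_lt.1 ((abs_im_le_norm w).trans_lt hw)).1
    have h2 := (abs_re_le_norm w).trans hw.le
    have hU : (X + K' * I : ℂ) + w ∈ UHP := by
      show 0 < ((X + K' * I : ℂ) + w).im
      simp; linarith
    have h3 := (hRD _ hU hD).1
    simp at h3
    have h4 := abs_sub_abs_le_abs_sub X (-w.re)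
    rw [sub_neg_eq_add, abs_neg] at h4
    linarith
  have hyK : y' < K' := hy'.2.trans_lt hKK'
  have hw : ((y' - K' : ℝ) * I : ℂ) ∈ ball (0 : ℂ) K' := by
    rw [mem_ball_zero_iff, norm_mul, norm_I, mul_one, norm_real, Real.norm_eq_abs, abs_lt]
    constructor <;> linarith [hy'.1]
  have he : (X + K' * I : ℂ) + ((y' - K' : ℝ) * I : ℂ) = X + y' * I := by push_cast; ring
  refine ⟨he ▸ hball _ hw, ?_⟩
  have hd : DifferentiableOn ℂ (fun w => I * g ((X + K' * I : ℂ) + w)) (ball 0 K') :=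
    (h.holo.comp (by fun_prop) hball).const_mul _
  have hmaps : MapsTo (fun w => I * g ((X + K' * I : ℂ) + w)) (ball 0 K') {z | z.re ≤ M} := by
    intro w hw
    have := h.nonneg _ (h.slit.subset_UHP (hball w hw))
    rw [h.eq_im _ (hball w hw)] at this
    show (I * _).re ≤ M
    rw [I_mul_re]; linarith
  have key := Complex.borelCaratheodory hM0 hd hmaps hK0 hw
  simp only [add_zero, he, norm_mul, norm_I, one_mul, mul_one, norm_real, Real.norm_eq_abs] at key
  have habs : |y' - K'| = K' - y' := by rw [abs_of_neg] <;> linarith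
  rw [habs] at key
  have hp : ‖g (X + K' * I)‖ < M := by
    refine hsmall _ ?_ (by simpa using hηK')
    refine lt_of_lt_of_le ?_ (abs_re_le_norm _)
    simp only [add_re, mul_re, ofReal_re, I_re, mul_zero, ofReal_im, I_im, mul_one, sub_self,
      add_zero]
    linarith
  have hyp := hy.trans_le hy'.1
  calc _ ≤ _ := key
    _ = (2 * M * (K' - y') + ‖g (X + K' * I)‖ * (K' + (K' - y'))) / y' := by
        rw [sub_sub_cancel, add_div]
    _ ≤ ε * y / y' := by
        gcongr
        have : M * (8 * K') = ε * y := by rw [hM]; field_simp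
        nlinarith [norm_nonneg (g (X + K' * I))]
    _ ≤ ε := by
        rw [div_le_iff₀ hyp]
        gcongr
        exact hy'.1

lemma continuous_horizontal_integral (hV : ContinuousOn V UHP) {a b y₁ : ℝ} (h₁ : 0 < y₁) :
    ContinuousOn (fun y : ℝ => ∫ x : ℝ in a..b, V (x + y * I)) (Ici y₁) := by
  have hc : Continuous fun q : ℝ × ℝ => V (q.2 + (max q.1 y₁ : ℝ) * I) := by
    refine hV.comp_continuous (by fun_prop) fun q => ?_
    show 0 < ((q.2 : ℂ) + (max q.1 y₁ : ℝ) * I).im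
    simp [h₁]
  have := intervalIntegral.continuous_parametric_intervalIntegral_of_continuous' (μ := volume)
    (f := fun y x : ℝ => V (x + (max y y₁ : ℝ) * I)) hc a b
  refine this.continuousOn.congr fun y hy => ?_
  simp only [max_eq_left (show y₁ ≤ y from hy)]

lemma re_intervalIntegrable_vertical (h : IsSlitPotential D g V η c) {x y₁ y₂ : ℝ} (h₂ : y₁ ≤ y₂)
    (hx : ∀ y ∈ Icc y₁ y₂, (x + y * I : ℂ) ∈ D) :
    IntervalIntegrable (fun y : ℝ => (g (x + y * I)).re) volume y₁ y₂ :=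
  (continuous_re.comp_continuousOn
    (continuousOn_vertical h.holo.continuousOn hx)).intervalIntegrable_of_Icc h₂

lemma horizontal_integral_sub_of_forall_notMem (h : IsSlitPotential D g V η c) {a b y₁ y₂ : ℝ}
    (hab : a ≤ b) (h₂ : y₁ ≤ y₂) (hD : Icc a b ×ℂ Icc y₁ y₂ ⊆ D) :
    (∫ x : ℝ in a..b, V (x + y₂ * I)) - ∫ x : ℝ in a..b, V (x + y₁ * I) =
      ∫ y : ℝ in y₁..y₂, ((g (b + y * I)).re - (g (a + y * I)).re) := by
  have h0 := rectInt_eq_zero_of_differentiableOn hab h₂ (h.holo.mono hD)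
  have hmem : ∀ x ∈ Icc a b, ∀ y ∈ Icc y₁ y₂, (x + y * I : ℂ) ∈ D := fun x hx y hy =>
    hD ⟨by simpa using hx, by simpa using hy⟩
  have e1 : ∀ y ∈ Icc y₁ y₂, ∫ x : ℝ in a..b, V (x + y * I) =
      (∫ x : ℝ in a..b, g (x + y * I)).im := fun y hy => by
    refine Eq.trans ?_ (imCLM.intervalIntegral_comp_comm (intervalIntegrable_horizontal
      h.holo.continuousOn hab fun x hx => hmem x hx y hy))
    refine intervalIntegral.integral_congr fun x hx => ?_
    rw [uIcc_of_le hab] at hx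
    exact h.eq_im _ (hmem x hx y hy)
  have e2 : ∀ x ∈ Icc a b, ∫ y : ℝ in y₁..y₂, (g (x + y * I)).re =
      (∫ y : ℝ in y₁..y₂, g (x + y * I)).re := fun x hx =>
    reCLM.intervalIntegral_comp_comm (intervalIntegrable_vertical
      h.holo.continuousOn h₂ fun y hy => hmem x hx y hy)
  have ha : a ∈ Icc a b := left_mem_Icc.2 hab
  have hb : b ∈ Icc a b := right_mem_Icc.2 hab
  rw [intervalIntegral.integral_sub (h.re_intervalIntegrable_vertical h₂ (hmem b hb))
    (h.re_intervalIntegrable_vertical h₂ (hmem a ha)), e1 _ (left_mem_Icc.2 h₂),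
    e1 _ (right_mem_Icc.2 h₂), e2 _ ha, e2 _ hb]
  have := congrArg Complex.im h0
  simp only [rectInt, sub_im, add_im, I_mul_im, zero_im] at this
  linarith

/-- The flux formula. -/
lemma horizontal_integral_sub (h : IsSlitPotential D g V η c) {a b y₁ y₂ : ℝ}
    (hab : a ≤ b) (h₁ : 0 < y₁) (h₂ : y₁ ≤ y₂) (ha : ∀ y ∈ Icc y₁ y₂, (a + y * I : ℂ) ∈ D)
    (hb : ∀ y ∈ Icc y₁ y₂, (b + y * I : ℂ) ∈ D) :
    (∫ x : ℝ in a..b, V (x + y₂ * I)) - ∫ x : ℝ in a..b, V (x + y₁ * I) =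
      ∫ y : ℝ in y₁..y₂, ((g (b + y * I)).re - (g (a + y * I)).re) := by
  obtain ⟨S, hS, hSD⟩ := h.slit.exists_heights
  have hk : ∀ {x : ℝ}, (∀ y ∈ Icc y₁ y₂, (x + y * I : ℂ) ∈ D) →
      ContinuousOn (fun y : ℝ => (g (x + y * I)).re) (Icc y₁ y₂) := fun hx =>
    continuous_re.comp_continuousOn (continuousOn_vertical h.holo.continuousOn hx)
  have hkc := (hk hb).sub (hk ha)
  refine (MeasureTheory.integral_eq_of_hasDerivAt_off_countable_of_le
    (fun y : ℝ => ∫ x : ℝ in a..b, V (x + y * I)) _ h₂ hS.countable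
    ((continuous_horizontal_integral h.cont h₁).mono Icc_subset_Ici_self) ?_
    (hkc.intervalIntegrable_of_Icc h₂)).symm
  rintro y ⟨hy, hyS⟩
  obtain ⟨e, he, hball⟩ := Metric.isOpen_iff.1 (isOpen_Ioo.inter hS.isClosed.isOpen_compl) y
    ⟨hy, hyS⟩
  rw [Real.ball_eq_Ioo] at hball
  set y₀ := y - e / 2 with hy₀
  have hsub : Ico y₀ (y + e) ⊆ Ioo y₁ y₂ ∩ Sᶜ := (Ico_subset_Ioo_left (by linarith)).trans hball
  have hI : Ico y₀ (y + e) ⊆ Icc y₁ y₂ := fun z hz => Ioo_subset_Icc_self (hsub hz).1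
  have hyI : y ∈ Ioo y₀ (y + e) := ⟨by linarith, by linarith⟩
  have hrect : ∀ y' ∈ Ico y₀ (y + e), (∫ x : ℝ in a..b, V (x + y' * I)) =
      (∫ x : ℝ in a..b, V (x + y₀ * I)) +
        ∫ y : ℝ in y₀..y', ((g (b + y * I)).re - (g (a + y * I)).re) := fun y' hy' => by
    rw [← h.horizontal_integral_sub_of_forall_notMem hab hy'.1]
    · ring
    · rintro z ⟨-, hz⟩
      have hz' := hsub ⟨hz.1, hz.2.trans_lt hy'.2⟩
      by_contra hzD
      exact hz'.2 (hSD z (h₁.trans hz'.1.1) hzD)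
  have hd : HasDerivAt (fun y' => (∫ x : ℝ in a..b, V (x + y₀ * I)) +
        ∫ y : ℝ in y₀..y', ((g (b + y * I)).re - (g (a + y * I)).re))
      ((g (b + y * I)).re - (g (a + y * I)).re) y := by
    refine (intervalIntegral.integral_hasDerivAt_right ?_ ?_ ?_).const_add _
    · refine (hkc.mono ?_).intervalIntegrable_of_Icc hyI.1.le
      exact (Icc_subset_Ico_right hyI.2).trans hI
    · exact (hkc.mono Ioo_subset_Icc_self).stronglyMeasurableAtFilter isOpen_Ioo y hy
    · exact hkc.continuousAt (Icc_mem_nhds hy.1 hy.2)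
  refine hd.congr_of_eventuallyEq ?_
  filter_upwards [Ioo_mem_nhds hyI.1 hyI.2] with y' hy'
  exact hrect y' (Ioo_subset_Ico_self hy')

end IsSlitPotential

lemma add_mul_I_mem_UHP {x y : ℝ} : (x + y * I : ℂ) ∈ UHP ↔ 0 < y := by
  simp [UHP]

namespace IsSlitPotential

variable {D : Set ℂ} {g : ℂ → ℂ} {V : ℂ → ℝ} {η c : ℝ}

lemma exists_norm_le_of_lt (h : IsSlitPotential D g V η c) {K : ℝ} (hK : η < K) :
    ∃ C : ℝ, ∀ z : ℂ, K ≤ z.im → ‖g z‖ ≤ C := by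
  obtain ⟨R, -, hsmall⟩ := exists_norm_lt_of_tendsto h.lim one_pos
  have hc : IsCompact ({z : ℂ | K ≤ z.im} ∩ closedBall 0 R) :=
    (isCompact_closedBall 0 R).inter_left (isClosed_le continuous_const continuous_im)
  obtain ⟨C, hC⟩ := hc.exists_bound_of_continuousOn (h.holo.continuousOn.mono fun z hz =>
    h.subset (show η < z.im from hK.trans_le hz.1))
  refine ⟨max C 1, fun z hz => ?_⟩
  by_cases hzR : ‖z‖ ≤ R
  · exact (hC z ⟨hz, mem_closedBall_zero_iff.2 hzR⟩).trans (le_max_left _ _)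
  · exact (hsmall z (not_le.1 hzR) (hK.trans_le hz)).le.trans (le_max_right _ _)

end IsSlitPotential

/-- Points on large circles tangent to the line `Im z = K` from above converge to points on the
line. -/
lemma tendsto_circleMap_horocycle (K x : ℝ) :
    Tendsto (fun ρ : ℝ => circleMap ((K + ρ : ℝ) * I) ρ (x / ρ - Real.pi / 2)) atTop
      (𝓝 (x + K * I)) := by
  have hd : HasDerivAt (fun s : ℝ => Complex.exp (x * s * I)) (x * I) 0 := by
    have h1 : HasDerivAt (fun s : ℂ => Complex.exp (x * s * I)) (x * I) ((0 : ℝ) : ℂ) := by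
      simpa using (((hasDerivAt_id ((0 : ℝ) : ℂ)).const_mul (x : ℂ)).mul_const I).cexp
    exact h1.comp_ofReal
  have h2 := hd.tendsto_slope_zero_right.comp tendsto_inv_atTop_nhdsGT_zero
  have h3 : Tendsto (fun ρ : ℝ => (K * I : ℂ) - I * (ρ * (Complex.exp (x * (ρ : ℂ)⁻¹ * I) - 1)))
      atTop (𝓝 ((K * I : ℂ) - I * (x * I))) := by
    refine tendsto_const_nhds.sub (Tendsto.const_mul _ (h2.congr fun ρ => ?_))
    simp
  have h4 : (K * I : ℂ) - I * (x * I) = x + K * I := by linear_combination (-x : ℂ) * I_mul_I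
  rw [h4] at h3
  refine h3.congr fun ρ => ?_
  have h5 : Complex.exp (((x / ρ - Real.pi / 2 : ℝ) : ℂ) * I) =
      Complex.exp (x * (ρ : ℂ)⁻¹ * I) * (-I) := by
    rw [show ((x / ρ - Real.pi / 2 : ℝ) : ℂ) * I = x * (ρ : ℂ)⁻¹ * I + -(Real.pi / 2 * I) by
      push_cast; ring, Complex.exp_add, Complex.exp_neg, Complex.exp_pi_div_two_mul_I, inv_I]
  rw [circleMap, h5]
  push_cast
  ring

namespace IsSlitPotential

variable {D : Set ℂ} {g : ℂ → ℂ} {V : ℂ → ℝ} {η c : ℝ}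

lemma integral_horocycle_le (h : IsSlitPotential D g V η c) {K X ρ : ℝ} (hK : η < K)
    (hX : 0 ≤ X) (hρ : 0 < ρ) (hXρ : X ≤ Real.pi * ρ) :
    ∫ x : ℝ in -X..X, (g (circleMap ((K + ρ : ℝ) * I) ρ (x / ρ - Real.pi / 2))).im ≤
      2 * Real.pi * ρ * (g ((K + ρ : ℝ) * I)).im := by
  set p : ℂ := (K + ρ : ℝ) * I with hp
  have him : ∀ z ∈ closedBall p ρ, η < z.im := fun z hz => by
    have h1 := (abs_le.1 ((abs_im_le_norm _).trans (mem_closedBall_iff_norm.1 hz))).1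
    simp [hp] at h1
    linarith
  have hU : ∀ z ∈ closedBall p ρ, 0 ≤ (g z).im := fun z hz => by
    rw [← h.eq_im z (h.subset (him z hz))]
    exact h.nonneg z (h.eta_nonneg.trans_lt (him z hz))
  have hmem : ∀ θ : ℝ, circleMap p ρ θ ∈ closedBall p ρ := fun θ =>
    circleMap_mem_closedBall p hρ.le θ
  have hcont : Continuous fun θ : ℝ => g (circleMap p ρ θ) :=
    h.holo.continuousOn.comp_continuous (continuous_circleMap p ρ) fun θ =>
      h.subset (him _ (hmem θ))
  have hcim : Continuous fun θ : ℝ => (g (circleMap p ρ θ)).im := continuous_im.comp hcont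
  have hdc : DiffContOnCl ℂ g (ball p |ρ|) := by
    refine DifferentiableOn.diffContOnCl (h.holo.mono ?_)
    rw [abs_of_pos hρ]
    exact (closure_ball_subset_closedBall).trans fun z hz => h.subset (him z hz)
  have hmean := hdc.circleAverage
  rw [Real.circleAverage_def] at hmean
  have hmv : ∫ θ : ℝ in (0 : ℝ)..2 * Real.pi, (g (circleMap p ρ θ)).im =
      2 * Real.pi * (g p).im := by
    have h1 : ∫ θ : ℝ in (0 : ℝ)..2 * Real.pi, (g (circleMap p ρ θ)).im =
        (∫ θ : ℝ in (0 : ℝ)..2 * Real.pi, g (circleMap p ρ θ)).im :=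
      imCLM.intervalIntegral_comp_comm (hcont.intervalIntegrable _ _)
    rw [h1, ← hmean, real_smul, ofReal_inv, ← ofReal_inv, re_ofReal_mul |> fun _ => im_ofReal_mul]
    field_simp
  have hper : Function.Periodic (fun θ : ℝ => (g (circleMap p ρ θ)).im) (2 * Real.pi) :=
    fun θ => by simp only [periodic_circleMap p ρ θ]
  have hsub := intervalIntegral.integral_comp_div_sub (a := -X) (b := X)
    (fun θ : ℝ => (g (circleMap p ρ θ)).im) hρ.ne' (Real.pi / 2)
  rw [hsub, smul_eq_mul]
  have hXπ : X / ρ ≤ Real.pi := (div_le_iff₀ hρ).2 hXρ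
  have hX0 : 0 ≤ X / ρ := by positivity
  have hneg : -X / ρ = -(X / ρ) := neg_div _ _
  have hmono : ∫ θ : ℝ in -X / ρ - Real.pi / 2..X / ρ - Real.pi / 2, (g (circleMap p ρ θ)).im ≤
      ∫ θ : ℝ in -Real.pi - Real.pi / 2..-Real.pi - Real.pi / 2 + 2 * Real.pi,
        (g (circleMap p ρ θ)).im := by
    refine intervalIntegral.integral_mono_interval (by linarith) (by linarith) (by linarith)
      (Eventually.of_forall fun θ => hU _ (hmem θ)) (hcim.intervalIntegrable _ _)
  rw [hper.intervalIntegral_add_eq _ 0, zero_add, hmv] at hmono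
  calc _ ≤ ρ * (2 * Real.pi * (g p).im) := mul_le_mul_of_nonneg_left hmono hρ.le
    _ = _ := by ring

lemma integral_im_le_of_lt (h : IsSlitPotential D g V η c) {K X : ℝ} (hK : η < K) (hX : 0 ≤ X) :
    ∫ x : ℝ in -X..X, V (x + K * I) ≤ 2 * Real.pi * c := by
  have hVg : ∀ x : ℝ, V (x + K * I) = (g (x + K * I)).im := fun x =>
    h.eq_im _ (h.subset (show η < _ by simpa using hK))
  simp only [hVg]
  obtain ⟨C, hC⟩ := h.exists_norm_le_of_lt hK
  have him : ∀ ρ : ℝ, 0 < ρ → ∀ θ : ℝ, K ≤ (circleMap ((K + ρ : ℝ) * I) ρ θ).im :=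
    fun ρ hρ θ => by
      have h1 := (abs_le.1 ((abs_im_le_norm _).trans
        (mem_closedBall_iff_norm.1 (circleMap_mem_closedBall ((K + ρ : ℝ) * I) hρ.le θ)))).1
      simp only [sub_im, im_ofReal_mul, I_im, mul_one] at h1
      linarith
  have hlim : Tendsto (fun ρ : ℝ => ∫ x : ℝ in -X..X,
      (g (circleMap ((K + ρ : ℝ) * I) ρ (x / ρ - Real.pi / 2))).im) atTop
      (𝓝 (∫ x : ℝ in -X..X, (g (x + K * I)).im)) := by
    refine intervalIntegral.tendsto_integral_filter_of_dominated_convergence (fun _ => C) ?_ ?_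
      (by simp) ?_
    · filter_upwards [eventually_gt_atTop 0] with ρ hρ
      refine Continuous.aestronglyMeasurable ?_
      refine continuous_im.comp (h.holo.continuousOn.comp_continuous ?_ fun x =>
        h.subset (hK.trans_le (him ρ hρ _)))
      exact (continuous_circleMap _ _).comp (by fun_prop)
    · filter_upwards [eventually_gt_atTop 0] with ρ hρ
      exact Eventually.of_forall fun x _ => (abs_im_le_norm _).trans (hC _ (him ρ hρ _))
    · refine Eventually.of_forall fun x _ => ?_
      have hat : ContinuousAt g (x + K * I) := (h.holo.continuousOn _ (h.subset
        (show η < _ by simpa using hK))).continuousAt (h.slit.isOpen.mem_nhds (h.subset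
        (show η < _ by simpa using hK)))
      exact (continuous_im.continuousAt.tendsto.comp hat.tendsto).comp
        (tendsto_circleMap_horocycle K x)
  have hlim2 : Tendsto (fun ρ : ℝ => 2 * Real.pi * ρ * (g ((K + ρ : ℝ) * I)).im) atTop
      (𝓝 (2 * Real.pi * c)) := by
    have hadd : Tendsto (fun ρ : ℝ => K + ρ) atTop atTop :=
      tendsto_atTop_add_const_left _ _ tendsto_id
    have h1 := h.res.comp hadd
    have h2 : Tendsto (fun ρ : ℝ => (g ((K + ρ : ℝ) * I)).im) atTop (𝓝 0) := by
      have := (continuous_im.tendsto 0).comp ((h.lim.comp (tendsto_mul_I_atTop η)).comp hadd)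
      simpa [Function.comp_def] using this
    have h3 := (h1.sub (h2.const_mul K)).const_mul (2 * Real.pi)
    rw [mul_zero, sub_zero] at h3
    refine h3.congr fun ρ => ?_
    simp only [Function.comp_apply]
    ring
  refine le_of_tendsto_of_tendsto hlim hlim2 ?_
  filter_upwards [eventually_gt_atTop 0, eventually_ge_atTop (X / Real.pi)] with ρ hρ hXρ
  exact h.integral_horocycle_le hK hX hρ (by
    rw [mul_comm]; exact (div_le_iff₀ Real.pi_pos).1 hXρ)

lemma continuous_horizontal (h : IsSlitPotential D g V η c) {y : ℝ} (hy : 0 < y) :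
    Continuous fun x : ℝ => V (x + y * I) :=
  h.cont.comp_continuous (by fun_prop) fun x => add_mul_I_mem_UHP.2 hy

lemma integral_horizontal_nonneg (h : IsSlitPotential D g V η c) {a b y : ℝ} (hab : a ≤ b)
    (hy : 0 < y) : 0 ≤ ∫ x : ℝ in a..b, V (x + y * I) :=
  intervalIntegral.integral_nonneg hab fun _ _ => h.nonneg _ (add_mul_I_mem_UHP.2 hy)

lemma abs_integral_re_le {x y₁ y₂ ε : ℝ} (h₂ : y₁ ≤ y₂)
    (hx : ∀ y ∈ Icc y₁ y₂, ‖g (x + y * I)‖ ≤ ε) :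
    |∫ y : ℝ in y₁..y₂, (g (x + y * I)).re| ≤ ε * (y₂ - y₁) := by
  rw [← abs_of_nonneg (sub_nonneg.2 h₂), ← Real.norm_eq_abs]
  refine intervalIntegral.norm_integral_le_of_norm_le_const fun y hy => ?_
  rw [uIoc_of_le h₂] at hy
  exact (abs_re_le_norm _).trans (hx y (Ioc_subset_Icc_self hy))

lemma integral_horizontal_le (h : IsSlitPotential D g V η c) {a b y : ℝ} (hab : a ≤ b)
    (hy : 0 < y) : ∫ x : ℝ in a..b, V (x + y * I) ≤ 2 * Real.pi * c := by
  set K := max η y + 1 with hK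
  have hKη : η < K := (le_max_left η y).trans_lt (by linarith)
  have hKy : y < K := (le_max_right η y).trans_lt (by linarith)
  refine le_of_forall_pos_le_add fun ε hε => ?_
  have hε' : 0 < ε / (2 * (K - y)) := div_pos hε (by linarith)
  obtain ⟨X₀, hX₀, hX⟩ := h.exists_norm_le_of_abs_re (K := K) hy hε'
  set X := max X₀ (max |a| |b|) with hXdef
  have hX0 : 0 < X := hX₀.trans_le (le_max_left _ _)
  have haX : |a| ≤ X := (le_max_left _ _).trans (le_max_right _ _)
  have hbX : |b| ≤ X := (le_max_right _ _).trans (le_max_right _ _)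
  have h1 := hX X (by rw [abs_of_pos hX0]; exact le_max_left _ _)
  have h2 := hX (-X) (by rw [abs_neg, abs_of_pos hX0]; exact le_max_left _ _)
  have hflux := h.horizontal_integral_sub (a := -X) (b := X) (by linarith) hy hKy.le
    (fun y hy => (h2 y hy).1) (fun y hy => (h1 y hy).1)
  rw [intervalIntegral.integral_sub (h.re_intervalIntegrable_vertical hKy.le fun y hy =>
    (h1 y hy).1) (h.re_intervalIntegrable_vertical hKy.le fun y hy => (h2 y hy).1)] at hflux
  have e1 := abs_le.1 (abs_integral_re_le hKy.le fun y hy => (h1 y hy).2)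
  have e2 := abs_le.1 (abs_integral_re_le hKy.le fun y hy => (h2 y hy).2)
  have e3 := h.integral_im_le_of_lt hKη hX0.le
  have e4 : ∫ x : ℝ in a..b, V (x + y * I) ≤ ∫ x : ℝ in -X..X, V (x + y * I) :=
    intervalIntegral.integral_mono_interval (abs_le.1 haX).1 hab (abs_le.1 hbX).2
      (Eventually.of_forall fun _ => h.nonneg _ (add_mul_I_mem_UHP.2 hy))
      ((h.continuous_horizontal hy).intervalIntegrable _ _)
  have e5 : ε / (2 * (K - y)) * (K - y) = ε / 2 := by
    have : K - y ≠ 0 := by linarith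
    field_simp
  rw [e5] at e1 e2
  linarith [e1.1, e2.2]

lemma residue_nonneg (h : IsSlitPotential D g V η c) : 0 ≤ c := by
  have h1 := h.integral_horizontal_nonneg (le_refl (0 : ℝ)) one_pos
  have h2 := h.integral_horizontal_le (le_refl (0 : ℝ)) one_pos
  have h3 := h1.trans h2
  have := Real.pi_pos
  by_contra! hc
  nlinarith

lemma abs_integral_vertical_le (h : IsSlitPotential D g V η c) {x y₁ y₂ : ℝ} (h₁ : 0 < y₁)
    (h₂ : y₁ ≤ y₂) (hx : ∀ y ∈ Icc y₁ y₂, (x + y * I : ℂ) ∈ D) :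
    |∫ y : ℝ in y₁..y₂, (g (x + y * I)).re| ≤ 2 * Real.pi * c := by
  refine le_of_forall_pos_le_add fun ε hε => ?_
  have hε' : 0 < ε / (y₂ - y₁ + 1) := div_pos hε (by linarith)
  obtain ⟨X₀, hX₀, hX⟩ := h.exists_norm_le_of_abs_re (K := y₂) h₁ hε'
  set X := max X₀ |x| with hXdef
  have hX0 : 0 < X := hX₀.trans_le (le_max_left _ _)
  have hxX : x ≤ X := (le_abs_self x).trans (le_max_right _ _)
  have h3 := hX X (by rw [abs_of_pos hX0]; exact le_max_left _ _)
  have hflux := h.horizontal_integral_sub hxX h₁ h₂ hx (fun y hy => (h3 y hy).1)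
  rw [intervalIntegral.integral_sub (h.re_intervalIntegrable_vertical h₂ fun y hy =>
    (h3 y hy).1) (h.re_intervalIntegrable_vertical h₂ hx)] at hflux
  have e1 := abs_le.1 (abs_integral_re_le h₂ fun y hy => (h3 y hy).2)
  have e2 := h.integral_horizontal_nonneg hxX h₁
  have e3 := h.integral_horizontal_nonneg hxX (h₁.trans_le h₂)
  have e4 := h.integral_horizontal_le hxX h₁
  have e5 := h.integral_horizontal_le hxX (h₁.trans_le h₂)
  have e6 : ε / (y₂ - y₁ + 1) * (y₂ - y₁) ≤ ε := by
    rw [div_mul_eq_mul_div, div_le_iff₀ (by linarith)]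
    nlinarith
  rw [abs_le]
  constructor <;> linarith [e1.1, e1.2]

lemma abs_im_primitive_sub_le (h : IsSlitPotential D g V η c) {B : Set ℂ} (hB : Convex ℝ B)
    (hBD : B ⊆ D) {P : ℂ → ℂ} (hP : ∀ w ∈ B, HasDerivAt P (g w) w) :
    (∀ a b y : ℝ, (a + y * I : ℂ) ∈ B → (b + y * I : ℂ) ∈ B →
      |(P (b + y * I) - P (a + y * I)).im| ≤ 2 * Real.pi * c) ∧
    ∀ x y₁ y₂ : ℝ, (x + y₁ * I : ℂ) ∈ B → (x + y₂ * I : ℂ) ∈ B →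
      |(P (x + y₂ * I) - P (x + y₁ * I)).im| ≤ 2 * Real.pi * c := by
  have hc : ContinuousOn g B := h.holo.continuousOn.mono hBD
  constructor
  · intro a b y ha hb
    wlog hab : a ≤ b generalizing a b
    · rw [← neg_sub, neg_im, abs_neg]
      exact this b a hb ha (le_of_not_ge hab)
    have hconv : Convex ℝ {x : ℝ | (x + y * I : ℂ) ∈ B} := by
      intro p hp q hq s t hs ht hst
      have := hB hp hq hs ht hst
      show ((s • p + t • q : ℝ) + y * I : ℂ) ∈ B
      convert this using 1
      have hst' : (s + t : ℂ) = 1 := by exact_mod_cast hst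
      simp only [real_smul, smul_eq_mul]
      push_cast
      linear_combination (-(y : ℂ) * I) * hst'
    have hmem : ∀ x ∈ Icc a b, (x + y * I : ℂ) ∈ B := fun x hx => hconv.ordConnected.out ha hb hx
    have hy : 0 < y := add_mul_I_mem_UHP.1 (h.slit.subset_UHP (hBD ha))
    have h1 := integral_horizontal_eq_sub hab hmem hc hP
    have h2 : ∫ x : ℝ in a..b, V (x + y * I) = (∫ x : ℝ in a..b, g (x + y * I)).im := by
      refine Eq.trans ?_ (imCLM.intervalIntegral_comp_comm
        (intervalIntegrable_horizontal hc hab hmem))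
      refine intervalIntegral.integral_congr fun x hx => ?_
      rw [uIcc_of_le hab] at hx
      exact h.eq_im _ (hBD (hmem x hx))
    rw [← h1, ← h2, abs_of_nonneg (h.integral_horizontal_nonneg hab hy)]
    exact h.integral_horizontal_le hab hy
  · intro x y₁ y₂ h₁ h₂
    wlog h₁₂ : y₁ ≤ y₂ generalizing y₁ y₂
    · rw [← neg_sub, neg_im, abs_neg]
      exact this y₂ y₁ h₂ h₁ (le_of_not_ge h₁₂)
    have hconv : Convex ℝ {y : ℝ | (x + y * I : ℂ) ∈ B} := by
      intro p hp q hq s t hs ht hst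
      have := hB hp hq hs ht hst
      show (x + (s • p + t • q : ℝ) * I : ℂ) ∈ B
      convert this using 1
      have hst' : (s + t : ℂ) = 1 := by exact_mod_cast hst
      simp only [real_smul, smul_eq_mul]
      push_cast
      linear_combination (-(x : ℂ)) * hst'
    have hmem : ∀ y ∈ Icc y₁ y₂, (x + y * I : ℂ) ∈ B := fun y hy =>
      hconv.ordConnected.out h₁ h₂ hy
    have hy : 0 < y₁ := add_mul_I_mem_UHP.1 (h.slit.subset_UHP (hBD h₁))
    have h1 := integral_vertical_eq_sub h₁₂ hmem hc hP
    have h2 : ∫ y : ℝ in y₁..y₂, (g (x + y * I)).re = (∫ y : ℝ in y₁..y₂, g (x + y * I)).re :=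
      reCLM.intervalIntegral_comp_comm (intervalIntegrable_vertical hc h₁₂ hmem)
    rw [← h1, I_mul_im, ← h2]
    exact h.abs_integral_vertical_le hy h₁₂ fun y hy => hBD (hmem y hy)

/-- The values of the function are controlled by its residue at infinity. -/
theorem norm_le (h : IsSlitPotential D g V η c) {z₀ : ℂ} {r : ℝ} (hr : 0 < r)
    (hball : ball z₀ r ⊆ D) : ‖g z₀‖ ≤ 8 * Real.pi * Real.exp 1 * c / r := by
  obtain ⟨P, hP⟩ := (h.holo.mono hball).isExactOn_ball
  obtain ⟨hh, hv⟩ := h.abs_im_primitive_sub_le (convex_ball z₀ r) hball hP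
  have hbound : ∀ z ∈ ball z₀ r, (P z - P z₀).im ≤ 4 * Real.pi * c := fun z hz => by
    have hcorner : (z.re + z₀.im * I : ℂ) ∈ ball z₀ r := by
      rw [mem_ball_iff_norm] at hz ⊢
      refine lt_of_le_of_lt ?_ hz
      have : (z.re + z₀.im * I : ℂ) - z₀ = ((z - z₀).re : ℂ) := by
        apply Complex.ext <;> simp
      rw [this, norm_real]
      exact abs_re_le_norm _
    have e1 := (abs_le.1 (hh z₀.re z.re z₀.im (by rwa [re_add_im, mem_ball, dist_self])
      hcorner)).2
    have e2 := (abs_le.1 (hv z.re z₀.im z.im hcorner (by rwa [re_add_im]))).2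
    rw [re_add_im] at e1 e2
    simp only [sub_im] at e1 e2 ⊢
    linarith
  have key : ∀ A : ℝ, 4 * Real.pi * c < A → ‖g z₀‖ ≤ 2 * Real.exp 1 / r * A := fun A hA => by
    have hA0 : 0 < A := lt_of_le_of_lt
      (mul_nonneg (by positivity) h.residue_nonneg) hA
    have hd : ∀ z ∈ ball z₀ r, HasDerivAt (fun z => Complex.exp (-I / A * (P z - P z₀)))
        (Complex.exp (-I / A * (P z - P z₀)) * (-I / A * g z)) z := fun z hz =>
      (((hP z hz).sub_const _).const_mul _).cexp
    have hcl : closedBall z₀ (r / 2) ⊆ ball z₀ r := closedBall_subset_ball (by linarith)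
    have hdc : DiffContOnCl ℂ (fun z => Complex.exp (-I / A * (P z - P z₀)))
        (ball z₀ (r / 2)) := by
      refine DifferentiableOn.diffContOnCl fun z hz => ?_
      exact (hd z (hcl (closure_ball_subset_closedBall hz))).differentiableAt.differentiableWithinAt
    have h1 := Complex.norm_deriv_le_of_forall_mem_sphere_norm_le (C := Real.exp 1) (half_pos hr)
      hdc fun z hz => by
        rw [norm_exp, Real.exp_le_exp]
        have e : (-I / A * (P z - P z₀)).re = (P z - P z₀).im / A := by
          rw [neg_div, neg_mul, neg_re, div_mul_eq_mul_div, div_ofReal_re, I_mul_re]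
          ring
        rw [e, div_le_one hA0]
        exact (hbound z (hcl (sphere_subset_closedBall hz))).trans hA.le
    rw [(hd z₀ (mem_ball_self hr)).deriv, sub_self, mul_zero, Complex.exp_zero, one_mul, norm_mul,
      norm_div, norm_neg, norm_I, norm_real, Real.norm_eq_abs, abs_of_pos hA0,
      div_mul_eq_mul_div, one_mul, div_le_iff₀ hA0] at h1
    exact h1.trans_eq (by field_simp)
  have hlim : Tendsto (fun A : ℝ => 2 * Real.exp 1 / r * A) (𝓝[>] (4 * Real.pi * c))
      (𝓝 (2 * Real.exp 1 / r * (4 * Real.pi * c))) :=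
    ((continuous_const.mul continuous_id).tendsto _).mono_left nhdsWithin_le_nhds
  refine (ge_of_tendsto hlim (eventually_mem_nhdsWithin.mono key)).trans_eq ?_
  field_simp
  ring

end IsSlitPotential

lemma IsParallelSlitHalfPlane.subset_closure {D : Set ℂ} (hsl : IsParallelSlitHalfPlane D) :
    UHP ⊆ closure D := by
  intro p hp
  obtain ⟨S, hS, hSD⟩ := hsl.exists_heights
  refine Metric.mem_closure_iff.2 fun ε hε => ?_
  obtain ⟨y, hy, hyS⟩ := hS.exists_notMem_Ioo (show p.im < p.im + ε by linarith)
  have hp0 : 0 < p.im := hp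
  refine ⟨p.re + y * I, ?_, ?_⟩
  · by_contra h
    have := hSD _ (add_mul_I_mem_UHP.2 (hp0.trans hy.1)) h
    simp at this
    exact hyS this
  · rw [Complex.dist_of_re_eq (by simp), dist_comm, Real.dist_eq]
    simp only [add_im, ofReal_im, im_ofReal_mul, I_im, mul_one, zero_add]
    rw [abs_of_pos (by linarith [hy.1])]
    linarith [hy.2]

lemma HP_anti {η η' : ℝ} (h : η ≤ η') : HP η' ⊆ HP η := fun _ hz => lt_of_le_of_lt h hz

/-- A hydrodynamically normalized univalent map of slit half-planes whose range omits a hull. -/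
structure IsHullMap (D D' : Set ℂ) (f : ℂ → ℂ) : Prop where
  slit : IsParallelSlitHalfPlane D
  slit' : IsParallelSlitHalfPlane D'
  mapsTo : MapsTo f D D'
  holo : DifferentiableOn ℂ f D
  inj : InjOn f D
  h1 : SatisfiesH1 D f
  hull : IsHHull (D' \ f '' D)

namespace IsHullMap

variable {D D' : Set ℂ} {f : ℂ → ℂ}

lemma exists_tendsto_im (h : IsHullMap D D' f) : ∃ S : Set ℝ, S.Finite ∧
    ∀ p ∈ UHP, p ∉ D → ∃ m ∈ S, Tendsto (fun z => (f z).im) (𝓝[D] p) (𝓝 m) := by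
  obtain ⟨S, hS, hSD⟩ := h.slit'.exists_heights
  obtain ⟨-, hcl, -, hsc⟩ := h.hull
  refine ⟨S, hS, fun p hp hpD => exists_tendsto_im_slit (G := UHP \ (D' \ f '' D)) h.slit h.holo
    h.inj h.h1 ?_ hsc ?_ hS ?_ hp hpD⟩
  · have : UHP \ (D' \ f '' D) = UHP ∩ (closure (D' \ f '' D))ᶜ := by
      ext z
      constructor
      · exact fun hz => ⟨hz.1, fun hz' => hz.2 (hcl ⟨hz', hz.1⟩)⟩
      · exact fun hz => ⟨hz.1, fun hz' => hz.2 (_root_.subset_closure hz')⟩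
    rw [this]
    exact isOpen_UHP.inter isClosed_closure.isOpen_compl
  · exact fun z hz => ⟨h.slit'.subset_UHP (h.mapsTo hz), fun hz' => hz'.2 (mem_image_of_mem f hz)⟩
  · exact fun w hw hwf => hSD w hw.1 fun hwD => hw.2 ⟨hwD, hwf⟩

/-- Hull maps push points upwards. -/
lemma im_le (h : IsHullMap D D' f) {z : ℂ} (hz : z ∈ D) : z.im ≤ (f z).im := by
  obtain ⟨S, hS, hlim⟩ := h.exists_tendsto_im
  obtain ⟨S', hS', hSD'⟩ := h.slit.exists_heights
  obtain ⟨η, -, hηD, hη⟩ := h.h1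
  have := im_nonneg_of_tendsto_slits (g := fun z => f z - z) h.slit
    (h.holo.sub differentiableOn_id) hηD hη (hS.image2 (fun m y => m - y) hS')
    (fun p hp hpD => by
      obtain ⟨m, hm, hmt⟩ := hlim p hp hpD
      exact ⟨m - p.im, mem_image2_of_mem hm (hSD' p hp hpD),
        hmt.sub ((continuous_im.tendsto p).mono_left nhdsWithin_le_nhds)⟩)
    (fun z hz => by
      have : 0 < (f z).im := h.slit'.subset_UHP (h.mapsTo hz)
      rw [sub_im]; linarith) hz
  rw [sub_im] at this
  linarith

end IsHullMap

lemma arg_mul_I_of_pos {Y : ℝ} (hY : 0 < Y) : arg ((Y : ℂ) * I) = Real.pi / 2 := by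
  rw [arg_real_mul _ hY, arg_I]

lemma SatisfiesH2.tendsto_mul_I {f : ℂ → ℂ} {c : ℂ} (h : SatisfiesH2 f c) :
    Tendsto (fun Y : ℝ => (Y : ℂ) * I * (f (Y * I) - Y * I)) atTop (𝓝 (-c)) := by
  have hpi := Real.pi_pos
  refine (h (Real.pi / 4) (by linarith) (by linarith)).comp (tendsto_inf.2
    ⟨(tendsto_inf.1 (tendsto_mul_I_atTop 0)).1, tendsto_principal.2 ?_⟩)
  filter_upwards [eventually_gt_atTop 0] with Y hY
  show _ < arg _ ∧ arg _ < _
  rw [arg_mul_I_of_pos hY]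
  constructor <;> linarith

/-- Composing with a hull map moves points by an amount controlled by the change of the angular
residue. -/
lemma IsHullMap.norm_sub_le {D D₁ D₂ : Set ℂ} {f F k : ℂ → ℂ} {cf cF : ℂ}
    (hf : IsHullMap D D₁ f) (hF : IsHullMap D D₂ F) (hk : IsHullMap D₁ D₂ k)
    (hcomp : ∀ z ∈ D, F z = k (f z)) (hcf : SatisfiesH2 f cf) (hcF : SatisfiesH2 F cF)
    {z : ℂ} {r : ℝ} (hr : 0 < r) (hball : ball z r ⊆ D) :
    ‖F z - f z‖ ≤ 8 * Real.pi * Real.exp 1 * (cF - cf).re / r := by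
  obtain ⟨η₁, h0, hD₁, hlim₁⟩ := hf.h1
  obtain ⟨η₂, -, hD₂, hlim₂⟩ := hF.h1
  obtain ⟨S₁, -, hS₁⟩ := hf.exists_tendsto_im
  obtain ⟨S₂, -, hS₂⟩ := hF.exists_tendsto_im
  have hgd : DifferentiableOn ℂ (fun z => F z - f z) D := hF.holo.sub hf.holo
  have hex : ∀ p ∈ UHP, ∃ m, Tendsto (fun z => (F z - f z).im) (𝓝[D] p) (𝓝 m) := fun p hp => by
    by_cases hpD : p ∈ D
    · exact ⟨_, (continuous_im.comp_continuousOn hgd.continuousOn) p hpD⟩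
    · obtain ⟨m₁, -, hm₁⟩ := hS₁ p hp hpD
      obtain ⟨m₂, -, hm₂⟩ := hS₂ p hp hpD
      exact ⟨m₂ - m₁, hm₂.sub hm₁⟩
  have hnn : ∀ z ∈ D, 0 ≤ (F z - f z).im := fun z hz => by
    rw [sub_im, hcomp z hz]
    linarith [hk.im_le (hf.mapsTo hz)]
  have hpot : IsSlitPotential D (fun z => F z - f z) (extendFrom D fun z => (F z - f z).im)
      (max η₁ η₂) (cF - cf).re :=
    { slit := hf.slit
      holo := hgd
      cont := continuousOn_extendFrom hf.slit.subset_closure hex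
      eq_im := fun p hp => extendFrom_eq (subset_closure hp)
        ((continuous_im.comp_continuousOn hgd.continuousOn) p hp)
      nonneg := fun p hp => by
        have : (𝓝[D] p).NeBot := mem_closure_iff_nhdsWithin_neBot.1 (hf.slit.subset_closure hp)
        exact ge_of_tendsto (tendsto_extendFrom (hex p hp)) (eventually_mem_nhdsWithin.mono hnn)
      eta_nonneg := h0.trans (le_max_left _ _)
      subset := (HP_anti (le_max_left _ _)).trans hD₁
      lim := by
        have e₁ := hlim₁.mono_left (inf_le_inf_left (cobounded ℂ)
          (principal_mono.2 (HP_anti (le_max_left η₁ η₂))))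
        have e₂ := hlim₂.mono_left (inf_le_inf_left (cobounded ℂ)
          (principal_mono.2 (HP_anti (le_max_right η₁ η₂))))
        have := e₂.sub e₁
        rw [sub_zero] at this
        exact this.congr fun z => by ring
      res := by
        have h := (continuous_re.tendsto _).comp (hcf.tendsto_mul_I.sub hcF.tendsto_mul_I)
        have e : (-cf - -cF).re = (cF - cf).re := by rw [neg_sub_neg]
        rw [e] at h
        refine h.congr fun Y => ?_
        simp only [Function.comp_apply, sub_re, mul_assoc, re_ofReal_mul, I_mul_re, sub_im]
        ring }
  exact hpot.norm_le hr hball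

namespace IsEvolutionFamily

variable {J : Set ℝ} {D : ℝ → Set ℂ} {φ : ℝ → ℝ → ℂ → ℂ} {lam : ℝ → ℂ}

lemma isHullMap (h : IsEvolutionFamily J D φ lam) {s t : ℝ} (hs : s ∈ J) (ht : t ∈ J)
    (hst : s ≤ t) : IsHullMap (D s) (D t) (φ t s) :=
  ⟨h.slit s hs, h.slit t ht, h.mapsTo s hs t ht hst, h.holo s hs t ht hst, h.inj s hs t ht hst,
    h.h1 s hs t ht hst, h.h3 s hs t ht hst⟩

/-- Additivity of the angular residue. -/
lemma residue_eq (h : IsEvolutionFamily J D φ lam) (h0 : (0 : ℝ) ∈ J) {s t : ℝ} (hs : s ∈ J)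
    (ht : t ∈ J) (h0s : 0 ≤ s) (hst : s ≤ t) {c : ℂ} (hc : SatisfiesH2 (φ t s) c) :
    c = lam t - lam s := by
  have hpi := Real.pi_pos
  obtain ⟨η, -, hηD, hη⟩ := h.h1 0 h0 s hs h0s
  set w : ℝ → ℂ := fun Y => φ s 0 (Y * I) with hw
  have hw0 : Tendsto (fun Y : ℝ => w Y - Y * I) atTop (𝓝 0) := hη.comp (tendsto_mul_I_atTop η)
  have hinv : Tendsto (fun Y : ℝ => ((Y : ℂ))⁻¹) atTop (𝓝 0) := by
    have := (continuous_ofReal.tendsto 0).comp tendsto_inv_atTop_zero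
    simpa [Function.comp_def] using this
  have hwY : Tendsto (fun Y : ℝ => (Y : ℂ)⁻¹ * w Y) atTop (𝓝 I) := by
    have := (hinv.mul hw0).add_const I
    rw [mul_zero, zero_add] at this
    refine this.congr' ?_
    filter_upwards [eventually_ne_atTop 0] with Y hY
    have : (Y : ℂ) ≠ 0 := ofReal_ne_zero.2 hY
    field_simp
    ring
  have harg : Tendsto (fun Y => arg (w Y)) atTop (𝓝 (Real.pi / 2)) := by
    have := (continuousAt_arg (x := I) (by simp [slitPlane])).tendsto.comp hwY
    rw [arg_I] at this
    refine this.congr' ?_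
    filter_upwards [eventually_gt_atTop 0] with Y hY
    rw [Function.comp_apply, ← ofReal_inv, arg_real_mul _ (inv_pos.2 hY)]
  have hwinf : Tendsto w atTop (cobounded ℂ ⊓ 𝓟 (Sector (Real.pi / 4))) := by
    refine tendsto_inf.2 ⟨?_, tendsto_principal.2 ?_⟩
    · have h1 : Tendsto (fun Y : ℝ => ‖(Y : ℂ) * I‖ - 1) atTop atTop :=
        tendsto_atTop_add_const_right _ _ (tendsto_norm_atTop_iff_cobounded.2
          (tendsto_inf.1 (tendsto_mul_I_atTop 0)).1)
      rw [← tendsto_norm_atTop_iff_cobounded]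
      refine tendsto_atTop_mono' _ ?_ h1
      filter_upwards [hw0.eventually (ball_mem_nhds 0 one_pos)] with Y hY
      rw [dist_zero_right] at hY
      have := norm_sub_norm_le ((Y : ℂ) * I) (w Y)
      rw [norm_sub_rev] at this
      linarith
    · exact harg.eventually (Ioo_mem_nhds (by linarith) (by linarith))
  have h1 := (hc (Real.pi / 4) (by linarith) (by linarith)).comp hwinf
  have h2 : Tendsto (fun Y : ℝ => (Y : ℂ) * I / w Y) atTop (𝓝 1) := by
    have := (hwY.inv₀ I_ne_zero).const_mul I
    rw [mul_inv_cancel₀ I_ne_zero] at this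
    refine this.congr fun Y => ?_
    rw [mul_inv, inv_inv]
    ring
  have h3 := (h2.mul h1).add (h.lam_res s hs).tendsto_mul_I
  have h4 := (h.lam_res t ht).tendsto_mul_I
  have h5 : Tendsto (fun Y : ℝ => (Y : ℂ) * I * (φ t 0 (Y * I) - Y * I)) atTop
      (𝓝 (1 * -c + -lam s)) := by
    refine h3.congr' ?_
    filter_upwards [(tendsto_principal.1 (tendsto_inf.1 (tendsto_mul_I_atTop η)).2),
      hwY.eventually_ne I_ne_zero] with Y hY hne
    have hwne : w Y ≠ 0 := right_ne_zero_of_mul hne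
    rw [h.ef2 0 h0 s hs t ht h0s hst _ (hηD hY)]
    simp only [Function.comp_apply]
    change (Y * I / w Y) * (w Y * (φ t s (w Y) - w Y)) + Y * I * (w Y - Y * I) =
      Y * I * (φ t s (w Y) - Y * I)
    field_simp
    ring
  have := tendsto_nhds_unique h4 h5
  linear_combination this

/-- Variation of an evolution family in the final time. -/
theorem norm_sub_le (h : IsEvolutionFamily J D φ lam) (h0 : (0 : ℝ) ∈ J) {s t u : ℝ} (hs : s ∈ J)
    (ht : t ∈ J) (hu : u ∈ J) (h0s : 0 ≤ s) (hst : s ≤ t) (htu : t ≤ u) {z : ℂ} {r : ℝ}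
    (hr : 0 < r) (hball : ball z r ⊆ D s) :
    ‖φ u s z - φ t s z‖ ≤ 8 * Real.pi * Real.exp 1 * (lam u - lam t).re / r := by
  obtain ⟨c₁, hc₁⟩ := h.h2 s hs t ht hst
  obtain ⟨c₂, hc₂⟩ := h.h2 s hs u hu (hst.trans htu)
  have e₁ := h.residue_eq h0 hs ht h0s hst hc₁
  have e₂ := h.residue_eq h0 hs hu h0s (hst.trans htu) hc₂
  have := (h.isHullMap hs ht hst).norm_sub_le (h.isHullMap hs hu (hst.trans htu))
    (h.isHullMap ht hu htu) (h.ef2 s hs t ht u hu hst htu) hc₁ hc₂ hr hball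
  rwa [e₁, e₂, sub_sub_sub_cancel_right] at this

end IsEvolutionFamily

namespace IsEvolutionFamily

variable {J : Set ℝ} {D : ℝ → Set ℂ} {φ : ℝ → ℝ → ℂ → ℂ} {lam : ℝ → ℂ}

lemma norm_sub_self_le (h : IsEvolutionFamily J D φ lam) (h0 : (0 : ℝ) ∈ J) {s t : ℝ} (hs : s ∈ J)
    (ht : t ∈ J) (h0s : 0 ≤ s) (hst : s ≤ t) {z : ℂ} {r : ℝ} (hr : 0 < r)
    (hball : ball z r ⊆ D s) :
    ‖φ t s z - z‖ ≤ 8 * Real.pi * Real.exp 1 * (lam t - lam s).re / r := by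
  have := h.norm_sub_le h0 hs hs ht h0s le_rfl hst hr hball
  rwa [h.ef1 s hs (hball (mem_ball_self hr))] at this

lemma norm_image_sub_le (h : IsEvolutionFamily J D φ lam) (h0 : (0 : ℝ) ∈ J) {s t : ℝ}
    (hs : s ∈ J) (ht : t ∈ J) (h0s : 0 ≤ s) (hst : s ≤ t) {z w : ℂ} {r : ℝ} (hr : 0 < r)
    (hball : ball z (2 * r) ⊆ D s) (hw : w ∈ ball z r) :
    ‖φ t s w - φ t s z‖ ≤
      (1 + 32 * Real.pi * Real.exp 1 * (lam t - lam s).re / r ^ 2) * ‖w - z‖ := by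
  have hd : DifferentiableOn ℂ (fun z => φ t s z - z) (D s) :=
    (h.holo s hs t ht hst).sub differentiableOn_id
  have hsub : ∀ x ∈ ball z r, ball x r ⊆ D s := fun x hx => by
    refine (ball_subset_ball' ?_).trans hball
    have := mem_ball.1 hx
    linarith
  have hderiv : ∀ x ∈ ball z r, ‖deriv (fun z => φ t s z - z) x‖ ≤
      32 * Real.pi * Real.exp 1 * (lam t - lam s).re / r ^ 2 := fun x hx => by
    have hcl : closedBall x (r / 2) ⊆ D s :=
      (closedBall_subset_ball (by linarith)).trans (hsub x hx)
    refine (Complex.norm_deriv_le_of_forall_mem_sphere_norm_le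
      (C := 8 * Real.pi * Real.exp 1 * (lam t - lam s).re / (r / 2)) (half_pos hr)
      (DifferentiableOn.diffContOnCl (hd.mono (closure_ball_subset_closedBall.trans hcl)))
      fun y hy => ?_).trans_eq ?_
    · refine h.norm_sub_self_le h0 hs ht h0s hst (half_pos hr) ((ball_subset_ball' ?_).trans
        (hsub x hx))
      rw [mem_sphere.1 hy]
      linarith
    · field_simp
      ring
  have hmem : ∀ x ∈ ball z r, x ∈ D s := fun x hx => hsub x hx (mem_ball_self hr)
  have key := (convex_ball z r).norm_image_sub_le_of_norm_deriv_le (fun x hx =>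
    (hd x (hmem x hx)).differentiableAt ((h.slit s hs).isOpen.mem_nhds (hmem x hx))) hderiv
    (mem_ball_self hr) hw
  calc ‖φ t s w - φ t s z‖ = ‖(φ t s w - w - (φ t s z - z)) + (w - z)‖ := by congr 1; ring
    _ ≤ _ := norm_add_le _ _
    _ ≤ _ := by rw [add_mul, one_mul, add_comm]; gcongr

/-- Variation of an evolution family in the initial time. -/
lemma norm_sub_initial_le (h : IsEvolutionFamily J D φ lam) (h0 : (0 : ℝ) ∈ J) {s s' t : ℝ}
    (hs : s ∈ J) (hs' : s' ∈ J) (ht : t ∈ J) (h0s : 0 ≤ s) (hss : s ≤ s') (hst : s' ≤ t) {z : ℂ}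
    {r : ℝ} (hr : 0 < r) (hball : ball z (2 * r) ⊆ D s) (hball' : ball z (2 * r) ⊆ D s')
    (hsmall : 8 * Real.pi * Real.exp 1 / r * |(lam s').re - (lam s).re| < r) :
    ‖φ t s' z - φ t s z‖ ≤ (1 + 32 * Real.pi * Real.exp 1 / r ^ 2 * |(lam t).re - (lam s').re|) *
      (8 * Real.pi * Real.exp 1 / r * |(lam s').re - (lam s).re|) := by
  have hz : z ∈ D s := hball (mem_ball_self (by linarith))
  have hmove : ‖φ s' s z - z‖ ≤ 8 * Real.pi * Real.exp 1 / r * |(lam s').re - (lam s).re| := by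
    refine (h.norm_sub_self_le h0 hs hs' h0s hss hr
      ((ball_subset_ball (by linarith)).trans hball)).trans ?_
    rw [mul_div_right_comm, sub_re]
    gcongr
    exact le_abs_self _
  rw [h.ef2 s hs s' hs' t ht hss hst z hz, norm_sub_rev]
  refine (h.norm_image_sub_le h0 hs' ht (h0s.trans hss) hst hr hball'
    (mem_ball_iff_norm.2 (hmove.trans_lt hsmall))).trans ?_
  rw [mul_div_right_comm (32 * Real.pi * Real.exp 1), sub_re]
  gcongr
  exact le_abs_self _

lemma norm_sub_final_le (h : IsEvolutionFamily J D φ lam) (h0 : (0 : ℝ) ∈ J) {s t u : ℝ}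
    (hs : s ∈ J) (ht : t ∈ J) (hu : u ∈ J) (h0s : 0 ≤ s) (hst : s ≤ t) (hsu : s ≤ u) {z : ℂ}
    {r : ℝ} (hr : 0 < r) (hball : ball z r ⊆ D s) :
    ‖φ t s z - φ u s z‖ ≤ 8 * Real.pi * Real.exp 1 / r * |(lam t).re - (lam u).re| := by
  wlog htu : u ≤ t generalizing t u
  · rw [norm_sub_rev, abs_sub_comm]
    exact this hu ht hsu hst (le_of_not_ge htu)
  refine (h.norm_sub_le h0 hs hu ht h0s hsu htu hr hball).trans ?_
  rw [mul_div_right_comm, sub_re]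
  gcongr
  exact le_abs_self _

end IsEvolutionFamily

/-- joint continuity `(s, t) ↦ φ t s` in the topology of locally
uniform convergence on `U`. -/
theorem statement3 {T : ℝ} (hT : 0 < T) {I : Set ℝ}
    (hI : I = Set.Ico 0 T ∨ I = Set.Icc 0 T)
    {D : ℝ → Set ℂ} {φ : ℝ → ℝ → ℂ → ℂ} {lam : ℝ → ℂ}
    (hEF : IsEvolutionFamily I D φ lam)
    {t₀ : ℝ} (ht₀ : t₀ ∈ I) {U : Set ℂ} (hU : IsOpen U)
    (hUb : Bornology.IsBounded U) (hU₀ : closure U ⊆ D t₀)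
    {δ : ℝ} (hδ : 0 < δ) (hUD : ∀ t ∈ I, |t - t₀| ≤ δ → closure U ⊆ D t)
    (s t : ℕ → ℝ) (S₀ T₀ : ℝ)
    (hmem : ∀ n, s n ∈ I ∧ |s n - t₀| ≤ δ ∧ t n ∈ I ∧ s n ≤ t n)
    (hlim : S₀ ∈ I ∧ |S₀ - t₀| ≤ δ ∧ T₀ ∈ I ∧ S₀ ≤ T₀)
    (hs : Tendsto s atTop (𝓝 S₀)) (ht : Tendsto t atTop (𝓝 T₀)) :
    TendstoLocallyUniformlyOn (fun n z => φ (t n) (s n) z) (φ T₀ S₀)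
      atTop U := by
  have h0 : (0 : ℝ) ∈ I := by rcases hI with rfl | rfl <;> simp [hT, hT.le]
  have hnn : ∀ a ∈ I, 0 ≤ a := by
    rcases hI with rfl | rfl <;> exact fun a ha => ha.1
  obtain ⟨hS₀, hS₀δ, hT₀, hST⟩ := hlim
  have hL : ∀ (a : ℕ → ℝ) (A : ℝ), A ∈ I → (∀ n, a n ∈ I) → Tendsto a atTop (𝓝 A) →
      Tendsto (fun n => (lam (a n)).re) atTop (𝓝 (lam A).re) := fun a A hA ha hlim =>
    (continuous_re.tendsto _).comp ((hEF.ef3 A hA).tendsto.comp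
      (tendsto_nhdsWithin_iff.2 ⟨hlim, Eventually.of_forall ha⟩))
  have hLs := hL s S₀ hS₀ (fun n => (hmem n).1) hs
  have hLt := hL t T₀ hT₀ (fun n => (hmem n).2.2.1) ht
  rw [tendstoLocallyUniformlyOn_iff_forall_isCompact hU]
  intro K hKU hK
  obtain ⟨ρ, hρ, hthick⟩ := hK.exists_thickening_subset_open hU hKU
  set r := ρ / 2 with hr
  have hr0 : 0 < r := half_pos hρ
  have hball : ∀ z ∈ K, ∀ a ∈ I, |a - t₀| ≤ δ → ball z (2 * r) ⊆ D a := fun z hz a ha haδ => by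
    have h2r : 2 * r = ρ := by rw [hr]; ring
    rw [h2r]
    exact (ball_subset_thickening hz ρ).trans
      (hthick.trans (subset_closure.trans (hUD a ha haδ)))
  have hballr : ∀ z ∈ K, ∀ a ∈ I, |a - t₀| ≤ δ → ball z r ⊆ D a := fun z hz a ha haδ =>
    (ball_subset_ball (by linarith)).trans (hball z hz a ha haδ)
  suffices hbound : ∃ e : ℕ → ℝ, Tendsto e atTop (𝓝 0) ∧
      ∀ᶠ n in atTop, ∀ z ∈ K, ‖φ (t n) (s n) z - φ T₀ S₀ z‖ ≤ e n by
    obtain ⟨e, he, hle⟩ := hbound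
    rw [Metric.tendstoUniformlyOn_iff]
    intro ε hε
    filter_upwards [hle, he.eventually_lt_const hε] with n hn hnε z hz
    rw [dist_comm, dist_eq_norm]
    exact (hn z hz).trans_lt hnε
  rcases hST.eq_or_lt with rfl | hlt
  · refine ⟨fun n => 8 * Real.pi * Real.exp 1 * ((lam (t n)).re - (lam (s n)).re) / r, ?_,
      Eventually.of_forall fun n z hz => ?_⟩
    · simpa using ((hLt.sub hLs).const_mul (8 * Real.pi * Real.exp 1)).div_const r
    · obtain ⟨h1, h2, h3, h4⟩ := hmem n
      rw [hEF.ef1 _ hS₀ (hball z hz S₀ hS₀ hS₀δ (mem_ball_self (by linarith))), id]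
      simp only [← sub_re]
      exact hEF.norm_sub_self_le h0 h1 h3 (hnn _ h1) h4 hr0 (hballr z hz _ h1 h2)
  · have hA : Tendsto (fun n => 8 * Real.pi * Real.exp 1 / r * |(lam (s n)).re - (lam S₀).re|)
        atTop (𝓝 0) := by
      simpa using ((hLs.sub_const (lam S₀).re).abs).const_mul (8 * Real.pi * Real.exp 1 / r)
    have hB : Tendsto (fun n => 8 * Real.pi * Real.exp 1 / r * |(lam (t n)).re - (lam T₀).re|)
        atTop (𝓝 0) := by
      simpa using ((hLt.sub_const (lam T₀).re).abs).const_mul (8 * Real.pi * Real.exp 1 / r)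
    have hC := ((((hLt.sub hLs).abs.add (hLt.sub_const (lam S₀).re).abs).const_mul
      (32 * Real.pi * Real.exp 1 / r ^ 2)).const_add 1).mul hA
    rw [mul_zero] at hC
    refine ⟨_, by simpa only [add_zero] using hC.add hB, ?_⟩
    filter_upwards [hA.eventually_lt_const hr0, ht.eventually_const_lt hlt] with n hn hnt z hz
    obtain ⟨h1, h2, h3, h4⟩ := hmem n
    refine (norm_sub_le_norm_sub_add_norm_sub _ (φ (t n) S₀ z) _).trans (add_le_add ?_ ?_)
    · rcases le_total S₀ (s n) with hle | hle
      · refine (hEF.norm_sub_initial_le h0 hS₀ h1 h3 (hnn _ hS₀) hle h4 hr0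
          (hball z hz _ hS₀ hS₀δ) (hball z hz _ h1 h2) hn).trans ?_
        gcongr
        exact le_add_of_nonneg_right (abs_nonneg _)
      · rw [abs_sub_comm] at hn
        rw [norm_sub_rev]
        refine (hEF.norm_sub_initial_le h0 h1 hS₀ h3 (hnn _ h1) hle hnt.le hr0
          (hball z hz _ h1 h2) (hball z hz _ hS₀ hS₀δ) hn).trans ?_
        rw [abs_sub_comm (lam S₀).re]
        gcongr
        exact le_add_of_nonneg_left (abs_nonneg _)
    · exact hEF.norm_sub_final_le h0 hS₀ h3 hT₀ (hnn _ hS₀) hnt.le hST hr0 (hballr z hz _ hS₀ hS₀δ)
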